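/- arXiv:1512.06935 — 2 statements merged into one kernel-verified Lean document; each statement's English description precedes it below -/
import Mathlib

section
/- Let r and s be multiplicatively independent integers ≥ 2 and let m₁, m₂ be positive rational numbers. The equation (m₂/m₁) r^{z₁} s^{−z₄} − (m₂/m₁) r^{z₂} s^{−z₄} + s^{z₃} = 1 has only finitely many solutions (z₁, z₂, z₃, z₄) in non-negative integers with z₃ ≥ 1 and z₁ ≠ z₂. -/
/-- Positive integers `r` and `s` are multiplicatively independent. -/
def MultIndep (r s : ℕ) : Prop := ∀ m n : ℕ, r ^ m = s ^ n → m = 0 ∧ n = 0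

open Polynomial Finset in
theorem aux_dvd (n : ℕ) (a : ℤ) :
    ((n.factorial : ℕ) : ℤ) ∣ 3 ^ n * ∏ i ∈ range n, (a - (3 * (i : ℤ) + 2)) := by
  obtain ⟨e, v, hv, h⟩ := Nat.exists_eq_pow_mul_and_not_dvd (Nat.factorial_ne_zero n) 3 (by norm_num)
  have he : e ≤ n := by
    have h1 : 3 ^ e ∣ n.factorial := ⟨v, h⟩
    have h4 : e ≤ padicValNat 3 (n.factorial) := by
      have : Fact (Nat.Prime 3) := ⟨Nat.prime_three⟩
      exact (padicValNat_dvd_iff_le (Nat.factorial_ne_zero n)).1 h1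
    have h5 := @sub_one_mul_padicValNat_factorial 3 ⟨Nat.prime_three⟩ n
    omega
  have hco : IsCoprime (3 : ℤ) (v : ℤ) := by
    have : Nat.Coprime 3 v := (Nat.Prime.coprime_iff_not_dvd Nat.prime_three).2 hv
    exact_mod_cast Nat.isCoprime_iff_coprime.2 this
  have hvd : (v : ℤ) ∣ ∏ i ∈ range n, (a - (3 * (i : ℤ) + 2)) := by
    obtain ⟨x, y, hxy⟩ := hco
    have hv1 : (v : ℤ) ∣ ∏ i ∈ range n, (x * (2 - a) + (i : ℤ)) := by
      refine dvd_trans ?_ (Nat.factorial_coe_dvd_prod n (x * (2 - a)))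
      exact_mod_cast (⟨3 ^ e, by rw [h]; ring⟩ : v ∣ n.factorial)
    have hm : (∏ i ∈ range n, (a - (3 * (i : ℤ) + 2))) ≡
        ∏ i ∈ range n, ((-3) * (x * (2 - a) + (i : ℤ))) [ZMOD v] := by
      apply Int.ModEq.prod
      intro i _
      apply Int.ModEq.symm
      rw [Int.modEq_iff_dvd]
      refine ⟨y * (a - 2), ?_⟩
      linear_combination (a - 2) * (-1) * hxy
    have h6 : (v : ℤ) ∣ ∏ i ∈ range n, ((-3) * (x * (2 - a) + (i : ℤ))) := by
      rw [Finset.prod_mul_distrib]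
      exact Dvd.dvd.mul_left hv1 _
    exact (Int.ModEq.dvd_iff hm).2 h6
  rw [h]
  push_cast
  exact mul_dvd_mul (pow_dvd_pow _ he) hvd

open Polynomial in
noncomputable def auxQ (k : ℕ) : ℝ[X] :=
  C ((3 : ℝ) ^ (k + 1) / ((k + 1).factorial : ℝ)) *
    ∏ i ∈ Finset.range (k + 1), (X - C (3 * (i : ℝ) + 2))

open Polynomial in
theorem auxQ_eval (k : ℕ) (x : ℝ) : (auxQ k).eval x =
    (3 : ℝ) ^ (k + 1) / ((k + 1).factorial : ℝ) *
      ∏ i ∈ Finset.range (k + 1), (x - (3 * (i : ℝ) + 2)) := by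
  simp [auxQ, eval_prod]

open Polynomial in
theorem auxQ_deg (k : ℕ) : (auxQ k).natDegree ≤ k + 1 := by
  unfold auxQ
  refine (natDegree_C_mul_le _ _).trans ?_
  rw [natDegree_finsetProd_X_sub_C_eq_card]
  simp

theorem auxQ_int (k e : ℕ) : ∃ z : ℤ, (auxQ k).eval (e : ℝ) = z := by
  obtain ⟨z, hz⟩ := aux_dvd (k + 1) e
  refine ⟨z, ?_⟩
  rw [auxQ_eval]
  have h : ((3 : ℝ) ^ (k + 1) * ∏ i ∈ Finset.range (k + 1), ((e : ℝ) - (3 * (i : ℝ) + 2))) =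
      ((k + 1).factorial : ℝ) * z := by exact_mod_cast hz
  have h0 : ((k + 1).factorial : ℝ) ≠ 0 := by exact_mod_cast Nat.factorial_ne_zero _
  field_simp
  linarith

theorem auxQ_bound (k e : ℕ) (he : e ≤ 3 * k + 3) : |(auxQ k).eval (e : ℝ)| ≤ 27 ^ (k + 1) := by
  rw [auxQ_eval, abs_mul, Finset.abs_prod]
  have h0 : (0 : ℝ) < ((k + 1).factorial : ℝ) := by exact_mod_cast Nat.factorial_pos _
  have h1 : ∏ i ∈ Finset.range (k + 1), |(e : ℝ) - (3 * (i : ℝ) + 2)| ≤ (3 * ((k : ℝ) + 1)) ^ (k + 1) := by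
    calc ∏ i ∈ Finset.range (k + 1), |(e : ℝ) - (3 * (i : ℝ) + 2)| 
        ≤ ∏ i ∈ Finset.range (k + 1), (3 * ((k : ℝ) + 1)) := by
          apply Finset.prod_le_prod
          · intros; positivity
          · intro i hi
            have hi' : (i : ℝ) ≤ k := by exact_mod_cast Nat.lt_succ_iff.1 (Finset.mem_range.1 hi)
            have he' : (e : ℝ) ≤ 3 * k + 3 := by exact_mod_cast he
            have : (0 : ℝ) ≤ i := by positivity
            have : (0 : ℝ) ≤ e := by positivity
            rw [abs_le]; constructor <;> linarith
      _ = _ := by simp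
  have h2 : ((k : ℝ) + 1) ^ (k + 1) / ((k + 1).factorial : ℝ) ≤ 3 ^ (k + 1) := by
    have := Real.pow_div_factorial_le_exp ((k : ℝ) + 1) (by positivity) (k + 1)
    refine this.trans ?_
    have h3 : Real.exp ((k : ℝ) + 1) = Real.exp 1 ^ (k + 1) := by
      rw [← Real.exp_nat_mul]; push_cast; ring_nf
    rw [h3]
    gcongr
    have := Real.exp_one_lt_d9
    linarith
  calc |(3 : ℝ) ^ (k + 1) / ((k + 1).factorial : ℝ)| * _ 
      ≤ (3 : ℝ) ^ (k + 1) / ((k + 1).factorial : ℝ) * (3 * ((k : ℝ) + 1)) ^ (k + 1) := by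
        rw [abs_of_pos (by positivity)]
        gcongr
    _ = 9 ^ (k + 1) * (((k : ℝ) + 1) ^ (k + 1) / ((k + 1).factorial : ℝ)) := by
        rw [mul_pow, show (9 : ℝ) = 3 * 3 by norm_num, mul_pow]; ring
    _ ≤ 9 ^ (k + 1) * 3 ^ (k + 1) := by gcongr
    _ = 27 ^ (k + 1) := by rw [← mul_pow]; norm_num

theorem auxQ_zero (k i : ℕ) (hi : i ≤ k) : (auxQ k).eval ((3 * i + 2 : ℕ) : ℝ) = 0 := by
  rw [auxQ_eval, Finset.prod_eq_zero (i := i)]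
  · simp
  · simp; omega
  · push_cast; ring

theorem auxQ_ne (k e : ℕ) (he : e % 3 ≠ 2) : (auxQ k).eval (e : ℝ) ≠ 0 := by
  rw [auxQ_eval]
  refine mul_ne_zero (by positivity) (Finset.prod_ne_zero_iff.2 ?_)
  intro i _ h
  have : (e : ℝ) = ((3 * i + 2 : ℕ) : ℝ) := by push_cast; linarith
  have : e = 3 * i + 2 := by exact_mod_cast this
  omega

/-- coefficient -/
noncomputable def auxc (k a i : ℕ) : ℝ :=
  (-1) ^ (3 * k + 2 - i) * ((3 * k + 2).choose i : ℝ) * (auxQ k).eval ((a + i : ℕ) : ℝ)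

open Polynomial in
theorem aux_annih (k a : ℕ) (p : ℝ[X]) (hp : p.natDegree < 2 * k + 1) :
    ∑ i ∈ Finset.range (3 * k + 3), auxc k a i * p.eval ((a + i : ℕ) : ℝ) = 0 := by
  have h := Polynomial.fwdDiff_iter_eq_zero_of_degree_lt (P := auxQ k * p) (n := 3 * k + 2) (by
    refine lt_of_le_of_lt natDegree_mul_le ?_
    have := auxQ_deg k
    omega)
  have h2 := congrFun h (a : ℝ)
  rw [fwdDiff_iter_eq_sum_shift] at h2
  rw [← (show _ = (0 : ℝ) from h2)]
  apply Finset.sum_congr rfl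
  intro i _
  simp [auxc]
  ring

theorem auxc_int (k a i : ℕ) : ∃ z : ℤ, auxc k a i = z := by
  obtain ⟨z, hz⟩ := auxQ_int k (a + i)
  refine ⟨(-1) ^ (3 * k + 2 - i) * ((3 * k + 2).choose i : ℤ) * z, ?_⟩
  rw [auxc, hz]; push_cast; ring

theorem auxc_bound (k a i : ℕ) (ha : a ≤ 1) (hi : i < 3 * k + 3) :
    |auxc k a i| ≤ ((3 * k + 2).choose i : ℝ) * 27 ^ (k + 1) := by
  rw [auxc, abs_mul, abs_mul]
  have := auxQ_bound k (a + i) (by omega)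
  simp only [abs_pow, abs_neg, abs_one, one_pow, one_mul, Nat.abs_cast]
  gcongr

theorem aux_sum_choose (k : ℕ) :
    ∑ i ∈ Finset.range (3 * k + 3), ((3 * k + 2).choose i : ℝ) ≤ 8 ^ (k + 1) := by
  have h := Nat.sum_range_choose (3 * k + 2)
  have h2 : ∑ i ∈ Finset.range (3 * k + 3), ((3 * k + 2).choose i : ℝ) = 2 ^ (3 * k + 2) := by
    exact_mod_cast h
  rw [h2, show (8 : ℝ) = 2 ^ 3 by norm_num, ← pow_mul]
  exact pow_le_pow_right₀ (by norm_num) (by omega)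

theorem aux_sum_choose_le (e M : ℕ) : 
    ∑ l ∈ Finset.range M, (e.choose l : ℝ) ≤ 2 ^ e := by
  have h : ∑ l ∈ Finset.range M, e.choose l ≤ 2 ^ e := by
    rw [← Nat.sum_range_choose]
    rw [← Finset.sum_subset (s₁ := (Finset.range M) ∩ (Finset.range (e + 1))) Finset.inter_subset_left]
    · exact Finset.sum_le_sum_of_subset Finset.inter_subset_right
    · intro x hx hx2
      apply Nat.choose_eq_zero_of_lt
      by_contra hc
      exact hx2 (Finset.mem_inter.2 ⟨hx, Finset.mem_range.2 (by omega)⟩)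
  exact_mod_cast h

theorem aux_expand (w : ℝ) (e M : ℕ) (h : e < M) :
    w ^ e = ∑ l ∈ Finset.range M, (w - 1) ^ l * (e.choose l : ℝ) := by
  have h1 : w ^ e = ((w - 1) + 1) ^ e := by ring
  rw [h1, add_pow]
  simp only [one_pow, mul_one]
  apply Finset.sum_subset
  · intro x; simp; omega
  · intro x _ hx
    rw [Nat.choose_eq_zero_of_lt]
    · simp
    · simp at hx; omega

open Polynomial in
theorem aux_F (k a : ℕ) (ha : a ≤ 1) (w : ℝ) (hw : |w - 1| ≤ 1) :
    |∑ i ∈ Finset.range (3 * k + 3), auxc k a i * w ^ (a + i)| ≤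
      1728 ^ (k + 1) * |w - 1| ^ (2 * k + 1) := by
  have e1 : ∑ i ∈ Finset.range (3 * k + 3), auxc k a i * w ^ (a + i) =
      ∑ l ∈ Finset.range (3 * k + 4), (w - 1) ^ l *
        ∑ i ∈ Finset.range (3 * k + 3), auxc k a i * ((a + i).choose l : ℝ) := by
    simp_rw [Finset.mul_sum]
    rw [Finset.sum_comm]
    apply Finset.sum_congr rfl
    intro i hi
    rw [aux_expand w (a + i) (3 * k + 4) (by have := Finset.mem_range.1 hi; omega), Finset.mul_sum]
    apply Finset.sum_congr rfl
    intros; ring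
  have e2 : ∀ l, l < 2 * k + 1 →
      ∑ i ∈ Finset.range (3 * k + 3), auxc k a i * ((a + i).choose l : ℝ) = 0 := by
    intro l hl
    rw [← aux_annih k a (C (1 / (l.factorial : ℝ)) * descPochhammer ℝ l) (by
      refine lt_of_le_of_lt (natDegree_C_mul_le _ _) ?_
      rw [descPochhammer_natDegree]; exact hl)]
    apply Finset.sum_congr rfl
    intro i _
    rw [eval_mul, descPochhammer_eval_eq_descFactorial, Nat.descFactorial_eq_factorial_mul_choose]
    have : (l.factorial : ℝ) ≠ 0 := by exact_mod_cast Nat.factorial_ne_zero _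
    simp
    left
    field_simp
  rw [e1]
  calc _ ≤ ∑ l ∈ Finset.range (3 * k + 4), |(w - 1) ^ l *
        ∑ i ∈ Finset.range (3 * k + 3), auxc k a i * ((a + i).choose l : ℝ)| :=
        Finset.abs_sum_le_sum_abs _ _
    _ ≤ ∑ l ∈ Finset.range (3 * k + 4), |w - 1| ^ (2 * k + 1) *
        ∑ i ∈ Finset.range (3 * k + 3), (((3 * k + 2).choose i : ℝ) * 27 ^ (k + 1)) * ((a + i).choose l : ℝ) := by
        apply Finset.sum_le_sum
        intro l _
        by_cases hl : l < 2 * k + 1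
        · rw [e2 l hl]; simp; positivity
        · rw [abs_mul, abs_pow]
          apply mul_le_mul _ _ (abs_nonneg _) (by positivity)
          · exact pow_le_pow_of_le_one (abs_nonneg _) hw (by omega)
          · refine (Finset.abs_sum_le_sum_abs _ _).trans ?_
            apply Finset.sum_le_sum
            intro i hi
            rw [abs_mul, Nat.abs_cast]
            gcongr
            exact auxc_bound k a i ha (Finset.mem_range.1 hi)
    _ = |w - 1| ^ (2 * k + 1) * ∑ i ∈ Finset.range (3 * k + 3), ((3 * k + 2).choose i : ℝ) * 27 ^ (k + 1) *
          ∑ l ∈ Finset.range (3 * k + 4), ((a + i).choose l : ℝ) := by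
        rw [← Finset.mul_sum, Finset.sum_comm]
        simp_rw [Finset.mul_sum]
    _ ≤ |w - 1| ^ (2 * k + 1) * ∑ i ∈ Finset.range (3 * k + 3), ((3 * k + 2).choose i : ℝ) * 27 ^ (k + 1) *
          8 ^ (k + 1) := by
        gcongr with i hi
        refine (aux_sum_choose_le _ _).trans ?_
        rw [show (8 : ℝ) = 2 ^ 3 by norm_num, ← pow_mul]
        apply pow_le_pow_right₀ (by norm_num)
        have := Finset.mem_range.1 hi
        omega
    _ = |w - 1| ^ (2 * k + 1) * ((∑ i ∈ Finset.range (3 * k + 3), ((3 * k + 2).choose i : ℝ)) * 27 ^ (k + 1) *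
          8 ^ (k + 1)) := by
        rw [Finset.sum_mul, Finset.sum_mul]
    _ ≤ |w - 1| ^ (2 * k + 1) * (8 ^ (k + 1) * 27 ^ (k + 1) * 8 ^ (k + 1)) := by
        gcongr
        exact aux_sum_choose k
    _ = _ := by
        rw [← mul_pow, ← mul_pow]; norm_num; ring

theorem aux_card (k : ℕ) : ((Finset.range (3 * k + 1)).filter (fun e => e % 3 ≠ 2)).card = 2 * k + 1 := by
  induction k with
  | zero => decide
  | succ k ih =>
    have h1 : (3 * k + 1) % 3 ≠ 2 := by omega
    have h2 : ¬ (3 * k + 2) % 3 ≠ 2 := by omega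
    have h3 : (3 * k + 3) % 3 ≠ 2 := by omega
    rw [show 3 * (k + 1) + 1 = 3 * k + 1 + 1 + 1 + 1 by ring, Finset.range_add_one, Finset.filter_insert,
      if_pos h3, Finset.range_add_one, Finset.filter_insert, if_neg h2, Finset.range_add_one,
      Finset.filter_insert, if_pos h1, Finset.card_insert_of_notMem, Finset.card_insert_of_notMem, ih]
    · ring
    · simp
    · simp

open Polynomial in
theorem aux_nonvanish (k : ℕ) (t : ℝ) (ht : t ≠ 1) (f : ℕ → ℝ) (hf : ∀ e, f (e + 3) = t * f e)
    (hf0 : f 0 = 1) :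
    ∃ a ≤ 1, ∑ i ∈ Finset.range (3 * k + 3), auxc k a i * f (a + i) ≠ 0 := by
  by_contra! hcon
  set S := (Finset.range (3 * k + 1)).filter (fun e => e % 3 ≠ 2) with hS
  have hinj : Set.InjOn (fun e : ℕ => (e : ℝ)) S := fun x _ y _ h => Nat.cast_injective h
  set p := Lagrange.interpolate S (fun e : ℕ => (e : ℝ)) f with hpdef
  have hdeg : p.degree < (2 * k + 1 : ℕ) := by
    rw [← aux_card k]
    exact Lagrange.degree_interpolate_lt f hinj
  have hpS : ∀ e ∈ S, p.eval (e : ℝ) = f e := fun e he => 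
    Lagrange.eval_interpolate_at_node f hinj he
  have hp0 : p.eval ((0 : ℕ) : ℝ) = f 0 := hpS 0 (by simp [hS])
  have hpne : p ≠ 0 := by
    intro h
    rw [h, hf0] at hp0
    simp at hp0
  have hnat : p.natDegree < 2 * k + 1 := (natDegree_lt_iff_degree_lt hpne).2 hdeg
  have key : ∀ a, a ≤ 1 → ∑ i ∈ Finset.range (3 * k + 3), auxc k a i * (p.eval ((a + i : ℕ) : ℝ) - f (a + i)) = 0 := by
    intro a ha
    simp_rw [mul_sub]
    rw [Finset.sum_sub_distrib, aux_annih k a p hnat, hcon a ha, sub_zero]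
  have hc0 : ∀ a i, (a + i) % 3 = 2 → a + i ≤ 3 * k + 3 → auxc k a i = 0 := by
    intro a i h h2
    have : a + i = 3 * ((a + i) / 3) + 2 := by omega
    rw [auxc, this, auxQ_zero, mul_zero]
    omega
  have hcne : ∀ a i, (a + i) % 3 ≠ 2 → i ≤ 3 * k + 2 → auxc k a i ≠ 0 := by
    intro a i h h2
    rw [auxc]
    refine mul_ne_zero (mul_ne_zero (by simp) ?_) (auxQ_ne k _ h)
    exact_mod_cast (Nat.choose_pos h2).ne'
  have n1 : p.eval ((3 * k + 1 : ℕ) : ℝ) = f (3 * k + 1) := by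
    have h := key 0 (by norm_num)
    rw [Finset.sum_eq_single (3 * k + 1)] at h
    · rcases mul_eq_zero.1 h with h | h
      · exact absurd h (hcne _ _ (by omega) (by omega))
      · simpa [sub_eq_zero] using h
    · intro i hi hne
      have := Finset.mem_range.1 hi
      by_cases h2 : (0 + i) % 3 = 2
      · rw [hc0 0 i h2 (by omega), zero_mul]
      · rw [hpS (0 + i) (by simp [hS]; omega), sub_self, mul_zero]
    · intro h; simp at h
  have n2 : p.eval ((3 * k + 3 : ℕ) : ℝ) = f (3 * k + 3) := by
    have h := key 1 (by norm_num)
    rw [Finset.sum_eq_single (3 * k + 2)] at h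
    · rcases mul_eq_zero.1 h with h | h
      · exact absurd h (hcne _ _ (by omega) (by omega))
      · rw [show 1 + (3 * k + 2) = 3 * k + 3 by ring] at h
        exact sub_eq_zero.1 h
    · intro i hi hne
      have := Finset.mem_range.1 hi
      by_cases h2 : (1 + i) % 3 = 2
      · rw [hc0 1 i h2 (by omega), zero_mul]
      · by_cases h3 : 1 + i = 3 * k + 1
        · rw [h3, n1, sub_self, mul_zero]
        · rw [hpS (1 + i) (by simp [hS]; omega), sub_self, mul_zero]
    · intro h; simp at h
  have hall : ∀ e, e ≤ 3 * k + 3 → e % 3 ≠ 2 → p.eval (e : ℝ) = f e := by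
    intro e he h2
    by_cases h3 : e = 3 * k + 1
    · rw [h3, n1]
    by_cases h4 : e = 3 * k + 3
    · rw [h4, n2]
    · exact hpS e (by simp [hS]; omega)
  have hq : taylor (3 : ℝ) p - C t * p = 0 := by
    by_contra hne
    have hdq : (taylor (3 : ℝ) p - C t * p).degree < (S.image (fun e : ℕ => (e : ℝ))).card := by
      rw [Finset.card_image_of_injOn hinj, aux_card k]
      refine lt_of_le_of_lt (degree_sub_le _ _) (max_lt ?_ ?_)
      · rw [degree_taylor]; exact hdeg
      · exact lt_of_le_of_lt ((degree_mul_le _ _).trans (by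
          have := degree_C_le (a := t)
          calc (C t).degree + p.degree ≤ 0 + p.degree := by gcongr
            _ = p.degree := zero_add _)) hdeg
    apply hne
    apply Polynomial.eq_zero_of_degree_lt_of_eval_finset_eq_zero _ hdq
    intro x hx
    obtain ⟨e, he, rfl⟩ := Finset.mem_image.1 hx
    have he' : e < 3 * k + 1 ∧ e % 3 ≠ 2 := by simpa [hS] using he
    rw [eval_sub, taylor_eval, eval_mul, eval_C, hpS e he]
    have h5 := hall (e + 3) (by omega) (by omega)
    rw [hf] at h5
    push_cast at h5
    rw [h5]; ring
  have hl : (taylor (3 : ℝ) p).leadingCoeff = (C t * p).leadingCoeff := by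
    rw [sub_eq_zero.1 hq]
  rw [leadingCoeff_taylor, leadingCoeff_mul, leadingCoeff_C] at hl
  have hlc : p.leadingCoeff ≠ 0 := leadingCoeff_ne_zero.2 hpne
  apply ht
  have : (t - 1) * p.leadingCoeff = 0 := by linarith
  rcases mul_eq_zero.1 this with h | h
  · linarith
  · exact absurd h hlc

/-- Main approximation inequality. -/
theorem aux_main (k : ℕ) (t ρ w : ℝ) (T V : ℕ) (P U : ℤ) (hT : 0 < T) (hV : 0 < V)
    (htP : t * T = P) (hρ : ρ * V = U) (ht : t ≠ 1) (hw3 : w ^ 3 = t) (hw : |w - 1| ≤ 1) :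
    1 ≤ (T : ℝ) ^ (k + 1) * V * (1728 ^ (k + 1) * (|w - 1| ^ (2 * k + 1) + |w - ρ|)) := by
  set f : ℕ → ℝ := fun e => (if e % 3 = 0 then 1 else ρ) * t ^ (e / 3) with hf
  obtain ⟨a, ha, hne⟩ := aux_nonvanish k t ht f (by
    intro e
    simp only [hf]
    rw [Nat.add_mod_right, Nat.add_div_right _ (by norm_num)]
    rw [pow_succ]; ring) (by simp [hf])
  set G := ∑ i ∈ Finset.range (3 * k + 3), auxc k a i * f (a + i) with hG
  -- integrality
  have hint : ∃ z : ℤ, G * ((T : ℝ) ^ (k + 1) * V) = z := by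
    have : ∀ i ∈ Finset.range (3 * k + 3), ∃ z : ℤ, auxc k a i * f (a + i) * ((T : ℝ) ^ (k + 1) * V) = z := by
      intro i hi
      have hi' := Finset.mem_range.1 hi
      obtain ⟨z, hz⟩ := auxc_int k a i
      have hj : (a + i) / 3 ≤ k + 1 := by omega
      obtain ⟨j', hj'⟩ := Nat.exists_eq_add_of_le hj
      have e1 : t ^ ((a + i) / 3) * (T : ℝ) ^ (k + 1) = ((P ^ ((a + i) / 3) * (T : ℤ) ^ j' : ℤ) : ℝ) := by
        push_cast
        rw [hj', pow_add, ← mul_assoc, ← mul_pow, htP]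
      have e2 : ∃ u : ℤ, (if (a + i) % 3 = 0 then (1 : ℝ) else ρ) * V = u := by
        split_ifs
        · exact ⟨V, by push_cast; ring⟩
        · exact ⟨U, hρ⟩
      obtain ⟨u, hu⟩ := e2
      refine ⟨z * (P ^ ((a + i) / 3) * (T : ℤ) ^ j') * u, ?_⟩
      rw [Int.cast_mul, Int.cast_mul, ← e1, ← hu, ← hz]
      simp only [hf]
      ring
    choose! z hz using this
    refine ⟨∑ i ∈ Finset.range (3 * k + 3), z i, ?_⟩
    rw [hG, Finset.sum_mul, Int.cast_sum]
    exact Finset.sum_congr rfl hz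
  have hpos : (0 : ℝ) < (T : ℝ) ^ (k + 1) * V := by positivity
  have hone : 1 ≤ |G| * ((T : ℝ) ^ (k + 1) * V) := by
    obtain ⟨z, hz⟩ := hint
    have h1 : |G| * ((T : ℝ) ^ (k + 1) * V) = |(z : ℝ)| := by
      rw [← hz, abs_mul, abs_of_pos hpos]
    have h2 : z ≠ 0 := by
      rintro rfl
      have : G * ((T : ℝ) ^ (k + 1) * V) ≠ 0 := mul_ne_zero hne hpos.ne'
      apply this; rw [hz]; simp
    rw [h1]
    exact_mod_cast Int.one_le_abs h2
  have hwabs := abs_le.1 hw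
  have hw0 : 0 ≤ w := by linarith
  have hw2 : w ≤ 2 := by linarith
  have hdiff : |G - ∑ i ∈ Finset.range (3 * k + 3), auxc k a i * w ^ (a + i)| ≤ 1728 ^ (k + 1) * |w - ρ| := by
    rw [hG, ← Finset.sum_sub_distrib]
    calc _ ≤ ∑ i ∈ Finset.range (3 * k + 3), |auxc k a i * f (a + i) - auxc k a i * w ^ (a + i)| :=
          Finset.abs_sum_le_sum_abs _ _
      _ ≤ ∑ i ∈ Finset.range (3 * k + 3), ((3 * k + 2).choose i : ℝ) * (27 ^ (k + 1) * (8 ^ (k + 1) * |w - ρ|)) := by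
          apply Finset.sum_le_sum
          intro i hi
          have hi' := Finset.mem_range.1 hi
          by_cases h2 : (a + i) % 3 = 2
          · have h3 : a + i = 3 * ((a + i) / 3) + 2 := by omega
            have : auxc k a i = 0 := by
              rw [auxc, h3, auxQ_zero, mul_zero]; omega
            rw [this]; simp; positivity
          · rw [← mul_sub, abs_mul, ← mul_assoc]
            apply mul_le_mul (auxc_bound k a i ha hi') _ (abs_nonneg _) (by positivity)
            have hwp : w ^ (a + i) = t ^ ((a + i) / 3) * w ^ ((a + i) % 3) := by
              rw [← hw3, ← pow_mul, ← pow_add, Nat.div_add_mod]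
            have ht0 : 0 ≤ t := by rw [← hw3]; positivity
            have ht8 : t ≤ 8 := by
              rw [← hw3]
              calc w ^ 3 ≤ 2 ^ 3 := by gcongr
                _ = 8 := by norm_num
            have htp : t ^ ((a + i) / 3) ≤ 8 ^ (k + 1) := by
              calc t ^ ((a + i) / 3) ≤ 8 ^ ((a + i) / 3) := by gcongr
                _ ≤ _ := pow_le_pow_right₀ (by norm_num) (by omega)
            rw [hwp]
            simp only [hf]
            have h01 : (a + i) % 3 = 0 ∨ (a + i) % 3 = 1 := by omega
            rcases h01 with h | h
            · simp [h]
            · simp only [h, one_ne_zero, if_false, pow_one]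
              rw [show ρ * t ^ ((a + i) / 3) - t ^ ((a + i) / 3) * w = t ^ ((a + i) / 3) * (ρ - w) by ring,
                abs_mul, abs_sub_comm, abs_of_nonneg (pow_nonneg ht0 _)]
              gcongr
      _ ≤ 8 ^ (k + 1) * (27 ^ (k + 1) * (8 ^ (k + 1) * |w - ρ|)) := by
          rw [← Finset.sum_mul]
          gcongr
          exact aux_sum_choose k
      _ = _ := by
          rw [← mul_assoc, ← mul_assoc, ← mul_pow, ← mul_pow]; norm_num
  have hF := aux_F k a ha w hw
  have hGle : |G| ≤ 1728 ^ (k + 1) * (|w - 1| ^ (2 * k + 1) + |w - ρ|) := by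
    set F := ∑ i ∈ Finset.range (3 * k + 3), auxc k a i * w ^ (a + i)
    have : |G| ≤ |F| + |G - F| := by
      have := abs_add_le F (G - F)
      simpa using this
    linarith
  calc 1 ≤ |G| * ((T : ℝ) ^ (k + 1) * V) := hone
    _ ≤ (1728 ^ (k + 1) * (|w - 1| ^ (2 * k + 1) + |w - ρ|)) * ((T : ℝ) ^ (k + 1) * V) := by gcongr
    _ = _ := by ring

theorem aux_cube (w : ℝ) (hw : 0 ≤ w) : |w - 1| ≤ |w ^ 3 - 1| := by
  rw [show w ^ 3 - 1 = (w - 1) * (w ^ 2 + w + 1) by ring, abs_mul]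
  have h : 1 ≤ |w ^ 2 + w + 1| := by
    rw [abs_of_nonneg (by positivity)]; nlinarith
  nlinarith [abs_nonneg (w - 1)]

theorem aux_root (t : ℝ) (ht : 0 < t) : ∃ w : ℝ, 0 < w ∧ w ^ 3 = t := by
  refine ⟨t ^ ((1 : ℝ) / 3), Real.rpow_pos_of_pos ht _, ?_⟩
  rw [← Real.rpow_natCast, ← Real.rpow_mul ht.le]
  norm_num

set_option maxHeartbeats 1000000 in
theorem aux_two (r s : ℕ) (hr : 2 ≤ r) (hs : 2 ≤ s) (u v : ℕ) (hu : 0 < u) (hv : 0 < v) :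
    ∃ Y0 : ℕ, ∀ x0 y0 x1 y1 : ℕ, Y0 ≤ y0 → 40 * y0 ≤ y1 → x0 ≤ x1 →
      x0 % 3 = x1 % 3 → y0 % 3 = y1 % 3 →
      |(u : ℝ) / v * r ^ x0 / s ^ y0 - 1| ≤ Real.exp (-(9 / 10) * (y0 * Real.log s)) →
      |(u : ℝ) / v * r ^ x1 / s ^ y1 - 1| ≤ Real.exp (-(9 / 10) * (y1 * Real.log s)) →
      (u : ℝ) / v * r ^ x0 / s ^ y0 ≠ 1 → False := by
  have hs' : (2 : ℝ) ≤ s := by exact_mod_cast hs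
  have hls : 0 < Real.log s := Real.log_pos (by linarith)
  have hu' : (0 : ℝ) < u := by exact_mod_cast hu
  have hv' : (0 : ℝ) < v := by exact_mod_cast hv
  have hr' : (0 : ℝ) < r := by exact_mod_cast (by omega : 0 < r)
  set c := |Real.log (2 * v / u)| with hc
  have hc0 : 0 ≤ c := abs_nonneg _
  obtain ⟨Y0, hY0⟩ := exists_nat_ge ((c + 10 + 20 * |Real.log (1728 * v)|) / Real.log s)
  refine ⟨Y0 + 1, ?_⟩
  intro x0 y0 x1 y1 hy0 hy1 hx hx3 hy3 h0 h1 hne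
  set L0 := y0 * Real.log s with hL0
  set L1 := y1 * Real.log s with hL1
  have hL0big : c + 10 + 20 * |Real.log (1728 * v)| ≤ L0 := by
    rw [div_le_iff₀ hls] at hY0
    refine hY0.trans ?_
    rw [hL0]
    have : (Y0 : ℝ) ≤ y0 := by exact_mod_cast (by omega : Y0 ≤ y0)
    gcongr
  have hlv := abs_nonneg (Real.log (1728 * v))
  have hlv2 := le_abs_self (Real.log (1728 * v))
  have hy0pos : 0 < y0 := by omega
  set k := y1 / (2 * y0) with hk
  have hk1 : 2 * y0 * k ≤ y1 := Nat.mul_div_le _ _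
  have hk2 : y1 ≤ 2 * y0 * (k + 1) := (Nat.lt_mul_div_succ y1 (by omega)).le
  have hk20 : 20 ≤ k := by
    rw [hk, Nat.le_div_iff_mul_le (by omega)]; omega
  have hk20' : (20 : ℝ) ≤ k := by exact_mod_cast hk20
  have hL1lo : 2 * (k * L0) ≤ L1 := by
    have : 2 * (y0 : ℝ) * k ≤ y1 := by exact_mod_cast hk1
    rw [hL0, hL1]; nlinarith
  have hL1hi : L1 ≤ 2 * (k * L0) + 2 * L0 := by
    have : (y1 : ℝ) ≤ 2 * (y0 : ℝ) * (k + 1) := by exact_mod_cast hk2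
    rw [hL0, hL1]; nlinarith
  have hkL : 20 * L0 ≤ k * L0 := by
    apply mul_le_mul_of_nonneg_right hk20'; linarith
  have hsL0 : (s : ℝ) ^ y0 = Real.exp L0 := by
    rw [hL0, Real.exp_nat_mul, Real.exp_log (by linarith)]
  have hsL1 : (s : ℝ) ^ y1 = Real.exp L1 := by
    rw [hL1, Real.exp_nat_mul, Real.exp_log (by linarith)]
  set t0 := (u : ℝ) / v * r ^ x0 / s ^ y0 with ht0
  set t1 := (u : ℝ) / v * r ^ x1 / s ^ y1 with ht1
  have hsp0 : (0 : ℝ) < (s : ℝ) ^ y0 := by positivity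
  have hsp1 : (0 : ℝ) < (s : ℝ) ^ y1 := by positivity
  have ht0p : 0 < t0 := by positivity
  have ht1p : 0 < t1 := by positivity
  have hhalf : Real.exp (-1) ≤ 1 / 2 := by
    rw [Real.exp_neg, inv_eq_one_div]
    have := Real.add_one_le_exp (1 : ℝ)
    apply one_div_le_one_div_of_le <;> linarith
  have hb0 : |t0 - 1| ≤ 1 / 2 := by
    refine (h0.trans (Real.exp_le_exp.2 ?_)).trans hhalf
    linarith
  have hb1 : |t1 - 1| ≤ 1 / 2 := by
    refine (h1.trans (Real.exp_le_exp.2 ?_)).trans hhalf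
    linarith
  have hb0' := abs_le.1 hb0
  have hb1' := abs_le.1 hb1
  obtain ⟨w0, hw0p, hw0⟩ := aux_root t0 ht0p
  obtain ⟨w1, hw1p, hw1⟩ := aux_root t1 ht1p
  obtain ⟨i, hi⟩ : ∃ i, x1 = x0 + 3 * i := ⟨(x1 - x0) / 3, by omega⟩
  obtain ⟨j, hj⟩ : ∃ j, y1 = y0 + 3 * j := ⟨(y1 - y0) / 3, by omega⟩
  set ρ : ℝ := (s : ℝ) ^ j / (r : ℝ) ^ i with hρ
  have hρp : 0 < ρ := by positivity
  have hρ3 : ρ ^ 3 * t1 = t0 := by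
    rw [hρ, ht1, ht0, hi, hj]
    field_simp
    ring
  have hρw : ρ * w1 = w0 := by
    have : (ρ * w1) ^ 3 = w0 ^ 3 := by rw [mul_pow, hw1, hw0, hρ3]
    exact (pow_left_inj₀ (by positivity) hw0p.le (by norm_num)).1 this
  have hρ2 : ρ ≤ 2 := by
    by_contra hcon
    push Not at hcon
    have : (2 : ℝ) ^ 3 < ρ ^ 3 := by gcongr
    nlinarith
  have hw0a : |w0 - 1| ≤ Real.exp (-(9 / 10) * L0) := by
    refine (aux_cube w0 hw0p.le).trans ?_
    rw [hw0]; exact h0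
  have hw1a : |w1 - 1| ≤ Real.exp (-(9 / 10) * L1) := by
    refine (aux_cube w1 hw1p.le).trans ?_
    rw [hw1]; exact h1
  have hwρ : |w0 - ρ| ≤ Real.exp (1 - (9 / 10) * L1) := by
    rw [← hρw, show ρ * w1 - ρ = ρ * (w1 - 1) by ring, abs_mul, abs_of_pos hρp,
      show 1 - 9 / 10 * L1 = 1 + -(9 / 10) * L1 by ring, Real.exp_add]
    apply mul_le_mul _ hw1a (abs_nonneg _) (Real.exp_pos _).le
    have := Real.add_one_le_exp (1 : ℝ)
    linarith
  have hmain := aux_main k t0 ρ w0 (v * s ^ y0) (r ^ i) (u * r ^ x0) (s ^ j)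
    (by positivity) (by positivity) (by
      rw [ht0]; push_cast; field_simp) (by
      rw [hρ]; push_cast; field_simp) hne hw0 (by
      refine ((aux_cube w0 hw0p.le).trans ?_).trans (by norm_num : (1 : ℝ) / 2 ≤ 1)
      rw [hw0]; exact hb0)
  push_cast at hmain
  -- bound on V
  have hV : (r : ℝ) ^ i ≤ Real.exp ((L1 + c) / 3) := by
    have h3 : ((r : ℝ) ^ i) ^ 3 ≤ (Real.exp ((L1 + c) / 3)) ^ 3 := by
      have e1 : (Real.exp ((L1 + c) / 3)) ^ 3 = Real.exp L1 * Real.exp c := by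
        rw [← Real.exp_nat_mul, ← Real.exp_add]; congr 1; push_cast; ring
      have e2 : 2 * v / u ≤ Real.exp c := by
        calc (2 * v / u : ℝ) = Real.exp (Real.log (2 * v / u)) := (Real.exp_log (by positivity)).symm
          _ ≤ _ := Real.exp_le_exp.2 (le_abs_self _)
      rw [e1, ← pow_mul, mul_comm i 3]
      have e3 : (r : ℝ) ^ x1 = v / u * t1 * Real.exp L1 := by
        rw [ht1, hsL1]
        have := (Real.exp_pos L1).ne'
        field_simp
      calc (r : ℝ) ^ (3 * i) ≤ (r : ℝ) ^ x1 := by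
            apply pow_le_pow_right₀
            · exact_mod_cast (by omega : 1 ≤ r)
            · omega
        _ = v / u * t1 * Real.exp L1 := e3
        _ ≤ v / u * 2 * Real.exp L1 := by gcongr; linarith
        _ = Real.exp L1 * (2 * v / u) := by ring
        _ ≤ _ := by gcongr
    exact (pow_le_pow_iff_left₀ (by positivity) (by positivity) (by norm_num)).1 h3
  have hT : ((v : ℝ) * (s : ℝ) ^ y0) ^ (k + 1) * 1728 ^ (k + 1) ≤
      Real.exp ((k + 1) * (21 / 20 * L0)) := by
    have e1 : (1728 * v : ℝ) ≤ Real.exp (L0 / 20) := by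
      calc (1728 * v : ℝ) = Real.exp (Real.log (1728 * v)) := (Real.exp_log (by positivity)).symm
        _ ≤ _ := Real.exp_le_exp.2 (by linarith)
    rw [← mul_pow, hsL0]
    have e2 : Real.exp (((k : ℝ) + 1) * (21 / 20 * L0)) = (Real.exp (L0 / 20) * Real.exp L0) ^ (k + 1) := by
      rw [← Real.exp_add, ← Real.exp_nat_mul]; congr 1; push_cast; ring
    rw [e2]
    apply pow_le_pow_left₀ (by positivity)
    calc (v : ℝ) * Real.exp L0 * 1728 = (1728 * v) * Real.exp L0 := by ring
      _ ≤ _ := by gcongr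
  have hpw : |w0 - 1| ^ (2 * k + 1) ≤ Real.exp ((2 * k + 1) * (-(9 / 10) * L0)) := by
    have e : Real.exp ((2 * k + 1) * (-(9 / 10) * L0)) = Real.exp (-(9 / 10) * L0) ^ (2 * k + 1) := by
      rw [← Real.exp_nat_mul]; congr 1; push_cast; ring
    rw [e]; gcongr
  have hfin : ((v : ℝ) * (s : ℝ) ^ y0) ^ (k + 1) * (r : ℝ) ^ i *
      (1728 ^ (k + 1) * (|w0 - 1| ^ (2 * k + 1) + |w0 - ρ|)) ≤
      Real.exp ((k + 1) * (21 / 20 * L0)) * Real.exp ((L1 + c) / 3) *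
      (Real.exp ((2 * k + 1) * (-(9 / 10) * L0)) + Real.exp (1 - (9 / 10) * L1)) := by
    calc _ = (((v : ℝ) * (s : ℝ) ^ y0) ^ (k + 1) * 1728 ^ (k + 1)) * (r : ℝ) ^ i *
          (|w0 - 1| ^ (2 * k + 1) + |w0 - ρ|) := by ring
      _ ≤ _ := by gcongr
  rw [← Real.exp_add, mul_add (Real.exp _), ← Real.exp_add, ← Real.exp_add] at hfin
  have hneg : Real.exp (-1) < 1 / 2 := by
    rw [Real.exp_neg, inv_eq_one_div]
    have := Real.add_one_lt_exp (x := (1 : ℝ)) (by norm_num)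
    apply one_div_lt_one_div_of_lt <;> linarith
  have f1 : Real.exp (((k : ℝ) + 1) * (21 / 20 * L0) + (L1 + c) / 3 + (2 * k + 1) * (-(9 / 10) * L0)) ≤
      Real.exp (-1) := by
    apply Real.exp_le_exp.2
    linarith
  have f2 : Real.exp (((k : ℝ) + 1) * (21 / 20 * L0) + (L1 + c) / 3 + (1 - (9 / 10) * L1)) ≤
      Real.exp (-1) := by
    apply Real.exp_le_exp.2
    linarith
  linarith

theorem aux_log (ε : ℝ) (hε : 0 < ε) : ∃ C : ℝ, ∀ c : ℕ, 1 ≤ c → Real.log c ≤ ε * c + C := by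
  refine ⟨-Real.log ε, ?_⟩
  intro c hc
  have hc' : (0 : ℝ) < c := by exact_mod_cast hc
  have h := Real.log_le_sub_one_of_pos (mul_pos hε hc')
  rw [Real.log_mul hε.ne' hc'.ne'] at h
  linarith

theorem aux_val_le (p c : ℕ) (hp : p.Prime) (hc : 1 ≤ c) :
    (padicValNat p c : ℝ) ≤ 2 * Real.log c := by
  have h1 : p ^ padicValNat p c ≤ c := Nat.le_of_dvd hc pow_padicValNat_dvd
  have h2 : (2 : ℝ) ^ padicValNat p c ≤ c := by
    calc (2 : ℝ) ^ padicValNat p c ≤ (p : ℝ) ^ padicValNat p c := by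
          gcongr; exact_mod_cast hp.two_le
      _ ≤ c := by exact_mod_cast h1
  have h3 := Real.log_le_log (by positivity) h2
  rw [Real.log_pow] at h3
  have h4 := Real.log_two_gt_d9
  have : (0 : ℝ) ≤ padicValNat p c := by positivity
  nlinarith

theorem aux_LTE (p s : ℕ) (hp : p.Prime) (hs : 2 ≤ s) :
    ∃ C : ℕ, ∀ c : ℕ, 1 ≤ c → padicValNat p (s ^ c - 1) ≤ C + padicValNat p c := by
  have : Fact p.Prime := ⟨hp⟩
  have hne : ∀ c, 1 ≤ c → s ^ c - 1 ≠ 0 := by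
    intro c hc
    have := Nat.one_lt_pow (by omega : c ≠ 0) (by omega : 1 < s)
    omega
  by_cases hps : p ∣ s
  · refine ⟨0, fun c hc => ?_⟩
    rw [padicValNat.eq_zero_of_not_dvd]
    · omega
    · intro h
      have h1 : p ∣ s ^ c := dvd_pow hps (by omega)
      have h2 := Nat.dvd_sub h1 h
      have h3 : s ^ c - (s ^ c - 1) = 1 := by
        have := hne c hc; omega
      rw [h3] at h2
      exact hp.one_lt.ne' (Nat.dvd_one.1 h2)
  · have hmono : ∀ c φ, 1 ≤ c → 1 ≤ φ → padicValNat p (s ^ c - 1) ≤ padicValNat p ((s ^ φ) ^ c - 1) := by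
      intro c φ hc hφ
      have hdvd : s ^ c - 1 ∣ (s ^ φ) ^ c - 1 := by
        rw [← pow_mul, mul_comm, pow_mul]
        simpa using Nat.sub_dvd_pow_sub_pow (s ^ c) 1 φ
      refine (padicValNat_dvd_iff_le ?_).1 (pow_padicValNat_dvd.trans hdvd)
      rw [← pow_mul]
      exact hne _ (Nat.mul_pos hφ hc)
    rcases hp.eq_two_or_odd' with h2 | hodd
    · subst h2
      refine ⟨padicValNat 2 (s ^ 2 - 1) , fun c hc => ?_⟩
      refine (hmono c 2 hc (by norm_num)).trans ?_
      have hsodd : Odd s := by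
        rw [← Nat.not_even_iff_odd, even_iff_two_dvd]; exact hps
      have h4 : (4 : ℤ) ∣ (s : ℤ) ^ 2 - 1 := by
        obtain ⟨q, hq⟩ := hsodd
        refine ⟨q ^ 2 + q, ?_⟩
        rw [hq]; push_cast; ring
      have h := Int.two_pow_sub_pow' (x := (s : ℤ) ^ 2) (y := 1) c h4 (by
        intro h
        apply hps
        have h' : 2 ∣ s ^ 2 := by exact_mod_cast h
        exact Nat.prime_two.dvd_of_dvd_pow h')
      have e1 : ((s : ℤ) ^ 2) ^ c - 1 ^ c = ((((s ^ 2) ^ c - 1 : ℕ)) : ℤ) := by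
        rw [Nat.cast_sub (Nat.one_le_pow _ _ (by positivity))]; push_cast; simp
      have e2 : (s : ℤ) ^ 2 - 1 = (((s ^ 2 - 1 : ℕ)) : ℤ) := by
        rw [Nat.cast_sub (Nat.one_le_pow _ _ (by positivity))]; push_cast; simp
      rw [e1, e2] at h
      have hn1 : (s ^ 2) ^ c - 1 ≠ 0 := by
        rw [← pow_mul]; exact hne _ (by omega)
      have hn2 := hne 2 (by norm_num)
      have cc : ∀ n : ℕ, emultiplicity (2 : ℤ) (n : ℤ) = emultiplicity 2 n := fun n => by
        exact_mod_cast Int.natCast_emultiplicity 2 n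
      rw [cc, cc, cc, ← padicValNat_eq_emultiplicity hn1, ← padicValNat_eq_emultiplicity hn2,
        ← padicValNat_eq_emultiplicity (by omega)] at h
      exact le_of_eq (by exact_mod_cast h)
    · refine ⟨padicValNat p (s ^ (p - 1) - 1), fun c hc => ?_⟩
      have hp1 : 1 ≤ p - 1 := by have := hp.two_le; omega
      refine (hmono c (p - 1) hc hp1).trans ?_
      have hcop : s.Coprime p := ((Nat.Prime.coprime_iff_not_dvd hp).2 hps).symm
      have hd : p ∣ s ^ (p - 1) - 1 := by
        have := Nat.ModEq.pow_totient hcop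
        rw [Nat.totient_prime hp] at this
        exact (Nat.modEq_iff_dvd' (Nat.one_le_pow _ _ (by omega))).1 this.symm
      have h := padicValNat.pow_sub_pow (p := p) (x := s ^ (p - 1)) (y := 1) hodd
        (Nat.one_lt_pow (by omega) (by omega)) hd (fun h => hps (hp.dvd_of_dvd_pow h)) (n := c) (by omega)
      rw [one_pow] at h
      exact h.le

theorem aux_val (p s : ℕ) (hp : p.Prime) (hs : 2 ≤ s) (ε : ℝ) (hε : 0 < ε) :
    ∃ C : ℝ, ∀ c : ℕ, 1 ≤ c → (padicValNat p (s ^ c - 1) : ℝ) ≤ ε * c + C := by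
  obtain ⟨C1, h1⟩ := aux_LTE p s hp hs
  obtain ⟨C2, h2⟩ := aux_log (ε / 2) (by positivity)
  refine ⟨C1 + 2 * C2, fun c hc => ?_⟩
  have a1 : (padicValNat p (s ^ c - 1) : ℝ) ≤ C1 + padicValNat p c := by exact_mod_cast h1 c hc
  have a2 := aux_val_le p c hp hc
  have a3 := h2 c hc
  linarith

theorem aux_det (r s : ℕ) (hr : 2 ≤ r) (hs : 2 ≤ s) (hind : MultIndep r s) :
    ∃ p q : ℕ, p.Prime ∧ q.Prime ∧
      padicValNat p r * padicValNat q s ≠ padicValNat q r * padicValNat p s := by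
  by_contra! hcon
  obtain ⟨p, hp, hpr⟩ := Nat.exists_prime_and_dvd (by omega : r ≠ 1)
  have : Fact p.Prime := ⟨hp⟩
  have hpos : 1 ≤ padicValNat p r := one_le_padicValNat_of_dvd (by omega) hpr
  have heq : r ^ padicValNat p s = s ^ padicValNat p r := by
    apply Nat.eq_of_factorization_eq (by positivity) (by positivity)
    intro q
    by_cases hq : q.Prime
    · have := hcon p q hp hq
      rw [Nat.factorization_pow, Nat.factorization_pow]
      simp only [Finsupp.smul_apply, smul_eq_mul, Nat.factorization_def _ hq]
      linarith
    · rw [Nat.factorization_eq_zero_of_not_prime _ hq, Nat.factorization_eq_zero_of_not_prime _ hq]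
  have := (hind _ _ heq).2
  omega

/-- The relation in natural numbers. -/
def auxSol (r s u v a d b c : ℕ) : Prop :=
  1 ≤ d ∧ 1 ≤ c ∧ u * (r ^ a * (r ^ d - 1)) = v * (s ^ b * (s ^ c - 1))

theorem aux_V (r s u v : ℕ) (hr : 2 ≤ r) (hs : 2 ≤ s) (hu : 0 < u) (hv : 0 < v) (p : ℕ) (hp : p.Prime)
    (ε : ℝ) (hε : 0 < ε) : ∃ C : ℝ, ∀ a d b c, auxSol r s u v a d b c →
      |(a : ℝ) * padicValNat p r - b * padicValNat p s| ≤ ε * (c + d) + C := by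
  obtain ⟨C1, h1⟩ := aux_val p r hp hr ε hε
  obtain ⟨C2, h2⟩ := aux_val p s hp hs ε hε
  refine ⟨|C1| + |C2| + padicValNat p u + padicValNat p v, ?_⟩
  rintro a d b c ⟨hd, hc, h⟩
  have : Fact p.Prime := ⟨hp⟩
  have n1 : r ^ d - 1 ≠ 0 := by
    have := Nat.one_lt_pow (by omega : d ≠ 0) (by omega : 1 < r)
    omega
  have n2 : s ^ c - 1 ≠ 0 := by
    have := Nat.one_lt_pow (by omega : c ≠ 0) (by omega : 1 < s)
    omega
  have n3 : r ^ a ≠ 0 := by positivity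
  have n4 : s ^ b ≠ 0 := by positivity
  have e := congrArg (padicValNat p) h
  rw [padicValNat.mul (by omega) (mul_ne_zero n3 n1), padicValNat.mul n3 n1,
    padicValNat.mul (by omega) (mul_ne_zero n4 n2), padicValNat.mul n4 n2,
    padicValNat.pow, padicValNat.pow] at e
  have e' : (padicValNat p u : ℝ) + (a * padicValNat p r + padicValNat p (r ^ d - 1)) =
    padicValNat p v + (b * padicValNat p s + padicValNat p (s ^ c - 1)) := by exact_mod_cast e
  have i1 := h1 d hd
  have i2 := h2 c hc
  have j1 : (0 : ℝ) ≤ padicValNat p (r ^ d - 1) := by positivity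
  have j2 : (0 : ℝ) ≤ padicValNat p (s ^ c - 1) := by positivity
  have j3 : (0 : ℝ) ≤ padicValNat p u := by positivity
  have j4 : (0 : ℝ) ≤ padicValNat p v := by positivity
  have k1 := le_abs_self C1
  have k2 := le_abs_self C2
  have k3 := abs_nonneg C1
  have k4 := abs_nonneg C2
  have k5 : 0 ≤ ε * c := by positivity
  have k6 : 0 ≤ ε * d := by positivity
  rw [abs_le]
  constructor <;> linarith

theorem aux_d (r s u v : ℕ) (hr : 2 ≤ r) (hs : 2 ≤ s) (hu : 0 < u) (hv : 0 < v) :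
    ∃ K C : ℝ, 0 < K ∧ 0 ≤ C ∧ ∀ a d b c, auxSol r s u v a d b c → (d : ℝ) ≤ K * (b + c) + C := by
  have hls : 0 < Real.log s := Real.log_pos (by exact_mod_cast (by omega : 1 < s))
  have hlr : 0 < Real.log r := Real.log_pos (by exact_mod_cast (by omega : 1 < r))
  have hlv : 0 ≤ Real.log v := Real.log_nonneg (by exact_mod_cast hv)
  refine ⟨Real.log s / Real.log r, Real.log v / Real.log r, by positivity, by positivity, ?_⟩
  rintro a d b c ⟨hd, hc, h⟩
  have h1 : r ^ d ≤ v * s ^ (b + c) := by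
    have i1 : r ^ d - 1 ≤ u * (r ^ a * (r ^ d - 1)) := by
      calc r ^ d - 1 = 1 * (1 * (r ^ d - 1)) := by ring
        _ ≤ _ := by
          gcongr
          · exact hu
          · exact Nat.one_le_pow _ _ (by omega)
    have i2 : v * (s ^ b * (s ^ c - 1)) < v * (s ^ b * s ^ c) := by
      have : 0 < s ^ c := by positivity
      gcongr
      omega
    rw [pow_add]
    omega
  have h2 : (r : ℝ) ^ d ≤ v * (s : ℝ) ^ (b + c) := by exact_mod_cast h1
  have hr0 : (0 : ℝ) < r := by exact_mod_cast (by omega : 0 < r)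
  have hs0 : (0 : ℝ) < s := by exact_mod_cast (by omega : 0 < s)
  have hv0 : (0 : ℝ) < v := by exact_mod_cast hv
  have h3 := Real.log_le_log (by positivity) h2
  rw [Real.log_pow, Real.log_mul (by positivity) (by positivity), Real.log_pow] at h3
  push_cast at h3
  rw [div_mul_eq_mul_div, ← add_div, le_div_iff₀ hlr]
  linarith

theorem aux_lin (α β γ δ a b E : ℝ) (h1 : |a * α - b * β| ≤ E) (h2 : |a * γ - b * δ| ≤ E)
    (hdet : 1 ≤ |α * δ - γ * β|) (ha : 0 ≤ a) (hb : 0 ≤ b) :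
    a ≤ (|β| + |δ|) * E ∧ b ≤ (|α| + |γ|) * E := by
  constructor
  · calc a ≤ a * |α * δ - γ * β| := by nlinarith
      _ = |(a * α - b * β) * δ - (a * γ - b * δ) * β| := by
        rw [← abs_of_nonneg ha, ← abs_mul, abs_of_nonneg ha]; congr 1; ring
      _ ≤ |(a * α - b * β) * δ| + |(a * γ - b * δ) * β| := abs_sub _ _
      _ = |a * α - b * β| * |δ| + |a * γ - b * δ| * |β| := by rw [abs_mul, abs_mul]
      _ ≤ E * |δ| + E * |β| := by gcongr
      _ = _ := by ring
  · calc b ≤ b * |α * δ - γ * β| := by nlinarith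
      _ = |(a * α - b * β) * γ - (a * γ - b * δ) * α| := by
        rw [← abs_of_nonneg hb, ← abs_mul, abs_of_nonneg hb]; congr 1; ring
      _ ≤ |(a * α - b * β) * γ| + |(a * γ - b * δ) * α| := abs_sub _ _
      _ = |a * α - b * β| * |γ| + |a * γ - b * δ| * |α| := by rw [abs_mul, abs_mul]
      _ ≤ E * |γ| + E * |α| := by gcongr
      _ = _ := by ring

theorem aux_AB (r s u v : ℕ) (hr : 2 ≤ r) (hs : 2 ≤ s) (hu : 0 < u) (hv : 0 < v) (hind : MultIndep r s)
    (ε : ℝ) (hε : 0 < ε) : ∃ C : ℝ, ∀ a d b c, auxSol r s u v a d b c →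
      (a : ℝ) ≤ ε * (b + c) + C ∧ (b : ℝ) ≤ ε * (b + c) + C := by
  obtain ⟨p, q, hp, hq, hdet⟩ := aux_det r s hr hs hind
  obtain ⟨K, C0, hK, hC0, hd⟩ := aux_d r s u v hr hs hu hv
  set M : ℝ := padicValNat p r + padicValNat p s + padicValNat q r + padicValNat q s + 1 with hM
  have hMpos : 0 < M := by positivity
  set η := ε / (M * (1 + K)) with hη
  have hηpos : 0 < η := by positivity
  obtain ⟨C1, h1⟩ := aux_V r s u v hr hs hu hv p hp η hηpos
  obtain ⟨C2, h2⟩ := aux_V r s u v hr hs hu hv q hq η hηpos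
  refine ⟨M * (η * C0 + |C1| + |C2|), ?_⟩
  intro a d b c hsol
  have hdd := hd a d b c hsol
  set E := η * ((1 + K) * (b + c) + C0) + |C1| + |C2| with hE
  have hb0 : (0 : ℝ) ≤ b := by positivity
  have hle : η * ((c : ℝ) + d) ≤ η * ((1 + K) * (b + c) + C0) := by
    apply mul_le_mul_of_nonneg_left _ hηpos.le
    nlinarith
  have k1 := le_abs_self C1
  have k2 := le_abs_self C2
  have k3 := abs_nonneg C1
  have k4 := abs_nonneg C2
  have hE0 : 0 ≤ E := by positivity
  have hdet' : (1 : ℝ) ≤ |(padicValNat p r : ℝ) * padicValNat q s - padicValNat q r * padicValNat p s| := by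
    have : ((padicValNat p r : ℤ) * padicValNat q s - padicValNat q r * padicValNat p s) ≠ 0 := by
      rw [sub_ne_zero]; exact_mod_cast hdet
    exact_mod_cast Int.one_le_abs this
  have hl := aux_lin _ _ _ _ (a : ℝ) (b : ℝ) E ((h1 a d b c hsol).trans (by linarith))
    ((h2 a d b c hsol).trans (by linarith)) hdet' (by positivity) hb0
  simp only [Nat.abs_cast] at hl
  have hME : M * E = ε * (b + c) + M * (η * C0 + |C1| + |C2|) := by
    have : M * (1 + K) * η = ε := by rw [hη]; field_simp
    rw [hE, ← this]; ring
  have g1 : (0 : ℝ) ≤ padicValNat p r := by positivity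
  have g2 : (0 : ℝ) ≤ padicValNat p s := by positivity
  have g3 : (0 : ℝ) ≤ padicValNat q r := by positivity
  have g4 : (0 : ℝ) ≤ padicValNat q s := by positivity
  rw [← hME]
  constructor
  · refine hl.1.trans ?_
    gcongr; linarith
  · refine hl.2.trans ?_
    gcongr; linarith

theorem aux_good (r s u v : ℕ) (hr : 2 ≤ r) (hs : 2 ≤ s) (hu : 0 < u) (hv : 0 < v) (hind : MultIndep r s) :
    ∃ Y : ℕ, ∀ a d b c, auxSol r s u v a d b c → Y ≤ b + c →
      |(u : ℝ) / v * r ^ (a + d) / s ^ (b + c) - 1| ≤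
        Real.exp (-(9 / 10) * ((b + c : ℕ) * Real.log s)) ∧
      (u : ℝ) / v * r ^ (a + d) / s ^ (b + c) ≠ 1 := by
  have hls : 0 < Real.log s := Real.log_pos (by exact_mod_cast (by omega : 1 < s))
  have hlr : 0 < Real.log r := Real.log_pos (by exact_mod_cast (by omega : 1 < r))
  have hr0 : (0 : ℝ) < r := by exact_mod_cast (by omega : 0 < r)
  have hs0 : (0 : ℝ) < s := by exact_mod_cast (by omega : 0 < s)
  have hu0 : (0 : ℝ) < u := by exact_mod_cast hu
  have hv0 : (0 : ℝ) < v := by exact_mod_cast hv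
  set ε := Real.log s / (20 * (Real.log r + Real.log s)) with hε
  have hεp : 0 < ε := by positivity
  have hε1 : ε * Real.log r ≤ Real.log s / 20 := by
    rw [hε, div_mul_eq_mul_div, div_le_div_iff₀ (by positivity) (by norm_num)]
    nlinarith [mul_pos hls hls]
  have hε2 : ε * Real.log s ≤ Real.log s / 20 := by
    rw [hε, div_mul_eq_mul_div, div_le_div_iff₀ (by positivity) (by norm_num)]
    nlinarith [mul_pos hls hlr]
  obtain ⟨C, hC⟩ := aux_AB r s u v hr hs hu hv hind ε hεp
  set D := (u : ℝ) / v * Real.exp (C * Real.log r) + Real.exp (C * Real.log s) with hD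
  have hDp : 0 < D := by positivity
  obtain ⟨Y, hY⟩ := exists_nat_ge (20 * Real.log D / Real.log s)
  refine ⟨Y, ?_⟩
  intro a d b c hsol hYle
  obtain ⟨hA, hB⟩ := hC a d b c hsol
  obtain ⟨hd, hc, h⟩ := hsol
  have hR : (u : ℝ) * (r ^ a * (r ^ d - 1)) = v * (s ^ b * (s ^ c - 1)) := by
    have i1 : 1 ≤ r ^ d := Nat.one_le_pow _ _ (by omega)
    have i2 : 1 ≤ s ^ c := Nat.one_le_pow _ _ (by omega)
    have := congrArg (Nat.cast (R := ℝ)) h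
    push_cast [Nat.cast_sub i1, Nat.cast_sub i2] at this
    exact this
  set y : ℝ := ((b + c : ℕ) : ℝ) with hy
  have hyeq : (b : ℝ) + c = y := by rw [hy]; push_cast; ring
  rw [hyeq] at hA hB
  have hyY : 20 * Real.log D ≤ y * Real.log s := by
    rw [div_le_iff₀ hls] at hY
    refine hY.trans ?_
    have : (Y : ℝ) ≤ y := by rw [hy]; exact_mod_cast hYle
    gcongr
  have hsy : (s : ℝ) ^ (b + c) = Real.exp (y * Real.log s) := by
    rw [hy, Real.exp_nat_mul, Real.exp_log hs0]
  have hdiff : (u : ℝ) / v * r ^ (a + d) / s ^ (b + c) - 1 =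
      ((u : ℝ) / v * r ^ a - s ^ b) / s ^ (b + c) := by
    field_simp
    rw [pow_add, pow_add]
    linarith
  have hra : (r : ℝ) ^ a ≤ Real.exp (C * Real.log r) * Real.exp (y * Real.log s / 20) := by
    rw [← Real.exp_add]
    calc (r : ℝ) ^ a = Real.exp (a * Real.log r) := by rw [Real.exp_nat_mul, Real.exp_log hr0]
      _ ≤ _ := by
        apply Real.exp_le_exp.2
        have : (a : ℝ) * Real.log r ≤ (ε * y + C) * Real.log r := by gcongr
        have hy0 : 0 ≤ y := by positivity
        nlinarith
  have hsb : (s : ℝ) ^ b ≤ Real.exp (C * Real.log s) * Real.exp (y * Real.log s / 20) := by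
    rw [← Real.exp_add]
    calc (s : ℝ) ^ b = Real.exp (b * Real.log s) := by rw [Real.exp_nat_mul, Real.exp_log hs0]
      _ ≤ _ := by
        apply Real.exp_le_exp.2
        have : (b : ℝ) * Real.log s ≤ (ε * y + C) * Real.log s := by gcongr
        have hy0 : 0 ≤ y := by positivity
        nlinarith
  constructor
  · rw [hdiff, abs_div, abs_of_pos (by positivity : (0 : ℝ) < s ^ (b + c)), div_le_iff₀ (by positivity),
      hsy, ← Real.exp_add]
    have b1 : |(u : ℝ) / v * r ^ a - s ^ b| ≤ (u : ℝ) / v * r ^ a + s ^ b := by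
      have : (0 : ℝ) < (u : ℝ) / v * r ^ a := by positivity
      have : (0 : ℝ) < (s : ℝ) ^ b := by positivity
      rw [abs_le]; constructor <;> linarith
    calc _ ≤ (u : ℝ) / v * r ^ a + s ^ b := b1
      _ ≤ (u : ℝ) / v * (Real.exp (C * Real.log r) * Real.exp (y * Real.log s / 20)) +
          Real.exp (C * Real.log s) * Real.exp (y * Real.log s / 20) := by gcongr
      _ = D * Real.exp (y * Real.log s / 20) := by rw [hD]; ring
      _ = Real.exp (Real.log D + y * Real.log s / 20) := by rw [Real.exp_add, Real.exp_log hDp]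
      _ ≤ _ := by
        apply Real.exp_le_exp.2
        linarith
  · intro heq
    rw [heq, sub_self] at hdiff
    have h0 : (u : ℝ) / v * r ^ a - s ^ b = 0 := by
      rcases div_eq_zero_iff.1 hdiff.symm with h | h
      · exact h
      · exact absurd h (by positivity)
    have h1 : (u : ℝ) * r ^ a = v * s ^ b := by
      field_simp at h0
      linarith
    have h2 : (v : ℝ) * s ^ b * (r ^ d - 1) = v * s ^ b * (s ^ c - 1) := by
      rw [mul_assoc (v : ℝ), mul_assoc (v : ℝ), ← hR, ← mul_assoc, ← mul_assoc, h1]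
    have h3 := mul_left_cancel₀ (by positivity : (v : ℝ) * s ^ b ≠ 0) h2
    have h4 : (r : ℝ) ^ d = (s : ℝ) ^ c := by linarith
    have h5 : r ^ d = s ^ c := by exact_mod_cast h4
    have := (hind _ _ h5).1
    omega

theorem aux_bounded (r s u v : ℕ) (hr : 2 ≤ r) (hs : 2 ≤ s) (hu : 0 < u) (hv : 0 < v) (hind : MultIndep r s) :
    ∃ Y : ℕ, ∀ a d b c, auxSol r s u v a d b c → b + c < Y := by
  by_contra! hcon
  obtain ⟨Y1, hY1⟩ := aux_good r s u v hr hs hu hv hind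
  obtain ⟨Y0, hY0⟩ := aux_two r s hr hs u v hu hv
  have hcls : ∃ i j : Fin 3, ∀ Y : ℕ, ∃ a d b c, auxSol r s u v a d b c ∧ Y ≤ b + c ∧
      (a + d) % 3 = i ∧ (b + c) % 3 = j := by
    by_contra! hno
    choose F hF using hno
    obtain ⟨a, d, b, c, hsol, hle⟩ := hcon (∑ i : Fin 3, ∑ j : Fin 3, F i j)
    set i : Fin 3 := ⟨(a + d) % 3, Nat.mod_lt _ (by norm_num)⟩
    set j : Fin 3 := ⟨(b + c) % 3, Nat.mod_lt _ (by norm_num)⟩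
    have h1 : F i j ≤ ∑ j : Fin 3, F i j := 
      Finset.single_le_sum (f := fun j => F i j) (fun _ _ => Nat.zero_le _) (Finset.mem_univ j)
    have h2 : ∑ j : Fin 3, F i j ≤ ∑ i : Fin 3, ∑ j : Fin 3, F i j :=
      Finset.single_le_sum (f := fun i => ∑ j : Fin 3, F i j) (fun _ _ => Nat.zero_le _) (Finset.mem_univ i)
    exact hF i j a d b c hsol (by omega) rfl rfl
  obtain ⟨i, j, hij⟩ := hcls
  obtain ⟨a0, d0, b0, c0, hs0, hle0, hi0, hj0⟩ := hij (Y0 + Y1)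
  obtain ⟨a1, d1, b1, c1, hs1, hle1, hi1, hj1⟩ :=
    hij (Y1 + 40 * (b0 + c0) + 2 * u * r ^ (a0 + d0))
  have g0 := hY1 _ _ _ _ hs0 (by omega)
  have g1 := hY1 _ _ _ _ hs1 (by omega)
  refine hY0 (a0 + d0) (b0 + c0) (a1 + d1) (b1 + c1) (by omega) (by omega) ?_ (by omega) (by omega)
    g0.1 g1.1 g0.2
  by_contra hlt
  push Not at hlt
  obtain ⟨hd, hc, h⟩ := hs1
  have k1 : s ^ (b1 + c1) ≤ 2 * (v * (s ^ b1 * (s ^ c1 - 1))) := by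
    have i1 : 2 ≤ s ^ c1 := hs.trans (Nat.le_self_pow (by omega) s)
    have i2 : s ^ c1 ≤ 2 * (s ^ c1 - 1) := by omega
    calc s ^ (b1 + c1) = 1 * (s ^ b1 * s ^ c1) := by rw [pow_add]; ring
      _ ≤ v * (s ^ b1 * (2 * (s ^ c1 - 1))) := by gcongr; exact hv
      _ = _ := by ring
  have k2 : u * (r ^ a1 * (r ^ d1 - 1)) ≤ u * r ^ (a0 + d0) := by
    gcongr
    calc r ^ a1 * (r ^ d1 - 1) ≤ r ^ a1 * r ^ d1 := by gcongr; omega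
      _ = r ^ (a1 + d1) := by rw [pow_add]
      _ ≤ _ := Nat.pow_le_pow_right (by omega) hlt.le
  have k3 : b1 + c1 < s ^ (b1 + c1) := Nat.lt_pow_self (by omega)
  have k4 : 2 * u * r ^ (a0 + d0) = 2 * (u * r ^ (a0 + d0)) := by ring
  omega


theorem stmt13 (r s : ℕ) (hr : 2 ≤ r) (hs : 2 ≤ s) (hind : MultIndep r s)
    (m₁ m₂ : ℚ) (hm₁ : 0 < m₁) (hm₂ : 0 < m₂) :
    {z : ℕ × ℕ × ℕ × ℕ | 1 ≤ z.2.2.1 ∧ z.1 ≠ z.2.1 ∧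
      ((m₂ / m₁ : ℚ) : ℝ) * (r : ℝ) ^ z.1 * (s : ℝ) ^ (-(z.2.2.2 : ℤ))
        - ((m₂ / m₁ : ℚ) : ℝ) * (r : ℝ) ^ z.2.1 * (s : ℝ) ^ (-(z.2.2.2 : ℤ))
        + (s : ℝ) ^ z.2.2.1 = 1}.Finite := by
  have hm : 0 < m₂ / m₁ := div_pos hm₂ hm₁
  generalize m₂ / m₁ = m at hm
  obtain ⟨u, v, hu, hv, hmuv⟩ : ∃ u v : ℕ, 0 < u ∧ 0 < v ∧ (m : ℝ) = (u : ℝ) / v := by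
    refine ⟨m.num.toNat, m.den, ?_, m.den_pos, ?_⟩
    · have := Rat.num_pos.2 hm; omega
    · have h1 : ((m.num.toNat : ℕ) : ℤ) = m.num := Int.toNat_of_nonneg (Rat.num_pos.2 hm).le
      have h2 : ((m.num.toNat : ℕ) : ℝ) = (m.num : ℝ) := by exact_mod_cast congrArg (Int.cast (R := ℝ)) h1
      rw [h2]; exact_mod_cast (Rat.num_div_den m).symm
  have hr0 : (0 : ℝ) < r := by exact_mod_cast (by omega : 0 < r)
  have hs0 : (0 : ℝ) < s := by exact_mod_cast (by omega : 0 < s)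
  have hu0 : (0 : ℝ) < u := by exact_mod_cast hu
  have hv0 : (0 : ℝ) < v := by exact_mod_cast hv
  obtain ⟨Y, hY⟩ := aux_bounded r s u v hr hs hu hv hind
  set B := v * s ^ Y + u * r ^ Y + Y with hB
  have hfin : (Set.Iic (v * s ^ Y + Y) ×ˢ (Set.Iic (v * s ^ Y + Y) ×ˢ (Set.Iic Y ×ˢ Set.Iic Y)) : Set (ℕ × ℕ × ℕ × ℕ)).Finite :=
    (Set.finite_Iic _).prod ((Set.finite_Iic _).prod ((Set.finite_Iic _).prod (Set.finite_Iic _)))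
  apply hfin.subset
  rintro ⟨z1, z2, z3, z4⟩ ⟨h3, h12, heq⟩
  simp only at h3 h12 heq
  rw [hmuv, zpow_neg, zpow_natCast] at heq
  have hsz : (0 : ℝ) < (s : ℝ) ^ z4 := by positivity
  have heq2 : (u : ℝ) * (r ^ z2 - r ^ z1) = v * (s ^ z4 * (s ^ z3 - 1)) := by
    field_simp at heq
    linarith
  have hs3 : (1 : ℝ) < (s : ℝ) ^ z3 := one_lt_pow₀ (by exact_mod_cast (by omega : 1 < s)) (by omega)
  have hlt : z1 < z2 := by
    by_contra hcon
    have : (r : ℝ) ^ z2 ≤ (r : ℝ) ^ z1 := pow_le_pow_right₀ (by exact_mod_cast (by omega : 1 ≤ r)) (by omega)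
    have p1 : 0 < (v : ℝ) * (s ^ z4 * (s ^ z3 - 1)) := by
      have : 0 < (s : ℝ) ^ z3 - 1 := by linarith
      positivity
    nlinarith
  obtain ⟨d, rfl⟩ := Nat.exists_eq_add_of_lt hlt
  have i1 : 1 ≤ r ^ (d + 1) := Nat.one_le_pow _ _ (by omega)
  have i2 : 1 ≤ s ^ z3 := Nat.one_le_pow _ _ (by omega)
  have hnat : u * (r ^ z1 * (r ^ (d + 1) - 1)) = v * (s ^ z4 * (s ^ z3 - 1)) := by
    have : (u : ℝ) * (r ^ z1 * (r ^ (d + 1) - 1)) = v * (s ^ z4 * (s ^ z3 - 1)) := by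
      rw [← heq2]; ring
    have h' : ((u * (r ^ z1 * (r ^ (d + 1) - 1)) : ℕ) : ℝ) = ((v * (s ^ z4 * (s ^ z3 - 1)) : ℕ) : ℝ) := by
      push_cast [Nat.cast_sub i1, Nat.cast_sub i2]
      exact this
    exact_mod_cast h'
  have hb := hY z1 (d + 1) z4 z3 ⟨by omega, h3, hnat⟩
  have hx : z1 + d ≤ v * s ^ Y := by
    have j1 : z1 + d < r ^ (z1 + d) := Nat.lt_pow_self (by omega)
    have j2 : r ^ d ≤ r ^ (d + 1) - 1 := by
      have : 0 < r ^ d := by positivity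
      have : 2 * r ^ d ≤ r ^ (d + 1) := by rw [pow_succ, mul_comm]; gcongr
      omega
    have j3 : r ^ (z1 + d) ≤ u * (r ^ z1 * (r ^ (d + 1) - 1)) := by
      calc r ^ (z1 + d) = 1 * (r ^ z1 * r ^ d) := by rw [pow_add]; ring
        _ ≤ _ := by gcongr; exact hu
    have j4 : v * (s ^ z4 * (s ^ z3 - 1)) ≤ v * s ^ Y := by
      gcongr
      calc s ^ z4 * (s ^ z3 - 1) ≤ s ^ z4 * s ^ z3 := by gcongr; omega
        _ = s ^ (z4 + z3) := by rw [pow_add]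
        _ ≤ _ := Nat.pow_le_pow_right (by omega) hb.le
    omega
  simp only [Set.mem_prod, Set.mem_Iic]
  omega
end

section
/- Let r and s be multiplicatively independent integers ≥ 2, and m₁, m₂ positive integers. Then there are only finitely many quadruples (u₁, v₁, u₂, v₂) of non-negative integers with v₁, v₂ ≥ 1 such that r^{u₁}(r^{v₁} − 1)/m₁ = s^{u₂}(s^{v₂} − 1)/m₂. -/
lemma aux_lcm : ∃ K : ℕ, 2 ≤ K ∧ ∀ k : ℕ, 1 ≤ k → ∃ D : ℕ, 0 < D ∧ (D : ℝ) ≤ (K : ℝ) ^ k ∧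
    ∀ i l : ℕ, i ≤ k → l ≤ k → (12 * ((i : ℤ) - l) + 1) ∣ (D : ℤ) := by
  obtain ⟨K, hK⟩ := exists_nat_ge (Real.exp ((Real.log 4 + 4) * 13))
  refine ⟨max K 2, le_max_right _ _, fun k hk => ⟨Nat.lcmUpto (12 * k + 1),
    Nat.lcmUpto_pos _, ?_, ?_⟩⟩
  · have h1 := Chebyshev.psi_le_const_mul_self (x := ((12 * k + 1 : ℕ) : ℝ)) (by positivity)
    rw [Chebyshev.psi_eq_log_lcmUpto] at h1
    have hpos : (0 : ℝ) < Nat.lcmUpto (12 * k + 1) := by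
      exact_mod_cast Nat.lcmUpto_pos _
    have hk' : (1 : ℝ) ≤ k := by exact_mod_cast hk
    have hl : 0 ≤ Real.log 4 := Real.log_nonneg (by norm_num)
    have h2 : Real.log (Nat.lcmUpto (12 * k + 1)) ≤ k * ((Real.log 4 + 4) * 13) := by
      refine h1.trans ?_
      push_cast
      nlinarith
    rw [Real.log_le_iff_le_exp hpos, Real.exp_nat_mul] at h2
    refine h2.trans ?_
    gcongr
    refine hK.trans ?_
    exact_mod_cast le_max_left _ _
  · intro i l hi hl
    rw [← Int.natAbs_dvd_natAbs]
    simp only [Int.natAbs_natCast]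
    unfold Nat.lcmUpto
    have hm : (12 * ((i : ℤ) - l) + 1).natAbs ∈ Finset.Icc 1 (12 * k + 1) := by
      rw [Finset.mem_Icc]; omega
    exact Finset.dvd_lcm (f := id) hm

lemma aux_expand_s14 (α : ℝ) (h0 : 0 < α) (h1 : α < 1) (k : ℕ) :
    ∫ t in α..1, ((1 - t ^ 12) * (1 - α ^ 12 * (t ^ 12)⁻¹)) ^ k =
      (∑ i ∈ Finset.range (k+1), ∑ l ∈ Finset.range (k+1),
        ((-1) ^ (i + l) * (k.choose i) * (k.choose l) * (α ^ 12) ^ l / ((12 * ((i : ℤ) - l) + 1 : ℤ) : ℝ)))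
      - α * (∑ i ∈ Finset.range (k+1), ∑ l ∈ Finset.range (k+1),
        ((-1) ^ (i + l) * (k.choose i) * (k.choose l) * (α ^ 12) ^ i / ((12 * ((i : ℤ) - l) + 1 : ℤ) : ℝ))) := by
  have hne : ∀ t ∈ Set.uIcc α 1, t ≠ 0 := by
    intro t ht
    rw [Set.uIcc_of_le h1.le] at ht
    exact (h0.trans_le ht.1).ne'
  have e1 : ∫ t in α..1, ((1 - t ^ 12) * (1 - α ^ 12 * (t ^ 12)⁻¹)) ^ k =
      ∫ t in α..1, ∑ i ∈ Finset.range (k+1), ∑ l ∈ Finset.range (k+1),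
        ((-1) ^ (i + l) * (k.choose i) * (k.choose l) * (α ^ 12) ^ l) * t ^ (12 * ((i : ℤ) - l)) := by
    apply intervalIntegral.integral_congr
    intro t ht
    have ht0 := hne t ht
    simp only
    rw [mul_pow, sub_eq_add_neg 1, sub_eq_add_neg 1, add_comm 1, add_comm 1, add_pow, add_pow,
      Finset.sum_mul_sum]
    refine Finset.sum_congr rfl fun i _ => Finset.sum_congr rfl fun l _ => ?_
    have : t ^ (12 * ((i : ℤ) - l)) = (t ^ 12) ^ i * ((t ^ 12)⁻¹) ^ l := by
      rw [mul_sub, zpow_sub₀ ht0, zpow_mul, zpow_mul, div_eq_mul_inv, inv_pow]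
      norm_cast
    rw [this, neg_pow, neg_pow (α ^ 12 * (t ^ 12)⁻¹), mul_pow]
    simp only [one_pow, pow_add]
    ring
  have h0n : (0:ℝ) ∉ Set.uIcc α 1 := fun h => hne 0 h rfl
  rw [e1, intervalIntegral.integral_finsetSum]
  · rw [Finset.mul_sum, ← Finset.sum_sub_distrib]
    refine Finset.sum_congr rfl fun i _ => ?_
    rw [intervalIntegral.integral_finsetSum]
    · rw [Finset.mul_sum, ← Finset.sum_sub_distrib]
      refine Finset.sum_congr rfl fun l _ => ?_
      rw [intervalIntegral.integral_const_mul, integral_zpow (Or.inr ⟨by omega, h0n⟩)]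
      have h5 : α ^ (12 * ((i : ℤ) - l) + 1) * (α ^ 12) ^ l = α * (α ^ 12) ^ i := by
        rw [← zpow_natCast, ← zpow_natCast, ← zpow_natCast, ← zpow_mul, ← zpow_mul,
          ← zpow_add₀ h0.ne', ← zpow_one_add₀ h0.ne']
        congr 1
        push_cast
        ring
      have hd : ((12 * ((i : ℤ) - l) + 1 : ℤ) : ℝ) ≠ 0 := by
        exact_mod_cast (by omega : (12 * ((i : ℤ) - l) + 1 : ℤ) ≠ 0)
      push_cast at hd ⊢
      rw [one_zpow]
      generalize (-1 : ℝ) ^ (i + l) * (k.choose i : ℝ) * (k.choose l : ℝ) = A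
      rw [mul_div_assoc', mul_div_assoc', ← sub_div]
      congr 1
      linear_combination (-A) * h5
    · intro l _
      apply IntervalIntegrable.const_mul
      exact intervalIntegral.intervalIntegrable_zpow (Or.inr h0n)
  · intro i _
    apply ContinuousOn.intervalIntegrable
    refine continuousOn_finsetSum _ fun l _ => ContinuousOn.mul continuousOn_const ?_
    exact ContinuousOn.zpow₀ continuousOn_id _ (fun t ht => Or.inl (hne t ht))

lemma aux_bounds (α : ℝ) (h0 : 0 < α) (h1 : α < 1) (k : ℕ) :
    (∫ t in α..1, ((1 - t ^ 12) * (1 - α ^ 12 * (t ^ 12)⁻¹)) ^ k) ≤ (1 - α ^ 12) ^ (2 * k) ∧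
    ((1 - α ^ 12) / 48) ^ (2 * k + 1) ≤
      (∫ t in α..1, ((1 - t ^ 12) * (1 - α ^ 12 * (t ^ 12)⁻¹)) ^ k) := by
  have hcont : ∀ a b, α ≤ a → a ≤ b → ContinuousOn
      (fun t : ℝ => ((1 - t ^ 12) * (1 - α ^ 12 * (t ^ 12)⁻¹)) ^ k) (Set.uIcc a b) := by
    intro a b ha hab
    rw [Set.uIcc_of_le hab]
    have : ∀ t ∈ Set.Icc a b, t ^ 12 ≠ 0 := by
      intro t ht
      have : 0 < t := by linarith [ht.1]
      positivity
    fun_prop (disch := assumption)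
  have hfac : ∀ t, α ≤ t → t ≤ 1 → 0 ≤ 1 - t ^ 12 ∧ 1 - t ^ 12 ≤ 1 - α ^ 12 ∧
      0 ≤ 1 - α ^ 12 * (t ^ 12)⁻¹ ∧ 1 - α ^ 12 * (t ^ 12)⁻¹ ≤ 1 - α ^ 12 := by
    intro t ha hb
    have ht : 0 < t := by linarith
    have h2 : t ^ 12 ≤ 1 := pow_le_one₀ ht.le hb
    have h3 : α ^ 12 ≤ t ^ 12 := by gcongr
    have h4 : 0 < t ^ 12 := by positivity
    have h5 : 1 ≤ (t ^ 12)⁻¹ := (one_le_inv₀ h4).2 h2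
    have h6 : 0 < α ^ 12 := by positivity
    refine ⟨by linarith, by linarith, ?_, ?_⟩
    · rw [← div_eq_mul_inv, sub_nonneg, div_le_one h4]; exact h3
    · nlinarith
  constructor
  · have hα : (0:ℝ) ≤ 1 - α ^ 12 := by
      have := (hfac 1 h1.le le_rfl).2.1
      norm_num at this ⊢; linarith
    calc (∫ t in α..1, ((1 - t ^ 12) * (1 - α ^ 12 * (t ^ 12)⁻¹)) ^ k)
        ≤ ∫ t in α..1, (1 - α ^ 12) ^ (2 * k) := by
          apply intervalIntegral.integral_mono_on h1.le (hcont α 1 le_rfl h1.le).intervalIntegrable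
            intervalIntegrable_const
          intro t ht
          obtain ⟨a, b, c, d⟩ := hfac t ht.1 ht.2
          rw [pow_mul, sq]
          gcongr
      _ ≤ _ := by
          rw [intervalIntegral.integral_const, smul_eq_mul]
          have : 0 ≤ (1 - α ^ 12) ^ (2 * k) := by positivity
          nlinarith
  · set β := α + (1 - α) / 4 with hβ
    set γ := 1 - (1 - α) / 4 with hγ
    have hbern : (1 - α ^ 12) / 12 ≤ 1 - α := by
      have := one_add_mul_le_pow (a := α - 1) (by linarith) 12
      norm_num at this
      linarith
    have he : 0 ≤ 1 - α ^ 12 := by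
      have : α ^ 12 ≤ 1 := pow_le_one₀ h0.le h1.le
      linarith
    calc ((1 - α ^ 12) / 48) ^ (2 * k + 1) ≤ ∫ t in β..γ, ((1 - α ^ 12) / 48) ^ (2 * k) := by
          rw [intervalIntegral.integral_const, smul_eq_mul, pow_succ, mul_comm]
          gcongr
          linarith
      _ ≤ ∫ t in β..γ, ((1 - t ^ 12) * (1 - α ^ 12 * (t ^ 12)⁻¹)) ^ k := by
          apply intervalIntegral.integral_mono_on (by linarith) intervalIntegrable_const
            (hcont β γ (by linarith) (by linarith)).intervalIntegrable
          intro t ht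
          obtain ⟨ht1, ht2⟩ := ht
          have ht0 : 0 < t := by linarith
          rw [pow_mul, sq]
          have ha : (1 - α ^ 12) / 48 ≤ 1 - t ^ 12 := by
            have : t ^ 12 ≤ t := pow_le_of_le_one ht0.le (by linarith) (by norm_num)
            linarith
          have hb : (1 - α ^ 12) / 48 ≤ 1 - α ^ 12 * (t ^ 12)⁻¹ := by
            rw [← div_eq_mul_inv, ← div_pow]
            have h2 : α / t ≤ 1 := by rw [div_le_one ht0]; linarith
            have : (α / t) ^ 12 ≤ α / t := pow_le_of_le_one (by positivity) h2 (by norm_num)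
            have h3 : 1 - α / t ≥ t - α := by
              rw [ge_iff_le, le_sub_iff_add_le, ← le_sub_iff_add_le', div_le_iff₀ ht0]
              nlinarith
            linarith
          have hc : 0 ≤ (1 - α ^ 12) / 48 := by positivity
          have hd : 0 ≤ 1 - t ^ 12 := hc.trans ha
          gcongr
      _ ≤ _ := by
          apply intervalIntegral.integral_mono_interval (by linarith) (by linarith) (by linarith)
          · filter_upwards [MeasureTheory.ae_restrict_mem measurableSet_Ioc] with t ht
            obtain ⟨a, b, c, d⟩ := hfac t ht.1.le ht.2
            simp only [Pi.zero_apply]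
            positivity
          · exact (hcont α 1 le_rfl h1.le).intervalIntegrable

lemma aux_int (x y k D : ℕ) (hy : 0 < y) (f : ℕ → ℕ → ℕ)
    (hf : ∀ i l, i ≤ k → l ≤ k → f i l ≤ k)
    (hD : ∀ i l : ℕ, i ≤ k → l ≤ k → (12 * ((i : ℤ) - l) + 1) ∣ (D : ℤ)) :
    ∃ z : ℤ, (D : ℝ) * (y : ℝ) ^ k * (∑ i ∈ Finset.range (k+1), ∑ l ∈ Finset.range (k+1),
        ((-1) ^ (i + l) * (k.choose i) * (k.choose l) * ((x : ℝ) / y) ^ (f i l) /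
          ((12 * ((i : ℤ) - l) + 1 : ℤ) : ℝ))) = z := by
  choose e he using hD
  refine ⟨∑ i ∈ (Finset.range (k+1)).attach, ∑ l ∈ (Finset.range (k+1)).attach,
    (-1) ^ (i.1 + l.1) * (k.choose i.1) * (k.choose l.1) * x ^ (f i.1 l.1) * y ^ (k - f i.1 l.1) *
      e i.1 l.1 (Nat.lt_succ_iff.1 (Finset.mem_range.1 i.2))
        (Nat.lt_succ_iff.1 (Finset.mem_range.1 l.2)), ?_⟩
  push_cast
  rw [← Finset.sum_attach, Finset.mul_sum]
  refine Finset.sum_congr rfl fun i _ => ?_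
  rw [← Finset.sum_attach, Finset.mul_sum]
  refine Finset.sum_congr rfl fun l _ => ?_
  have hi := Nat.lt_succ_iff.1 (Finset.mem_range.1 i.2)
  have hl := Nat.lt_succ_iff.1 (Finset.mem_range.1 l.2)
  have h1 := he i.1 l.1 hi hl
  have hd : ((12 * ((i.1 : ℤ) - l.1) + 1 : ℤ) : ℝ) ≠ 0 := by
    exact_mod_cast (by omega : (12 * ((i.1 : ℤ) - l.1) + 1 : ℤ) ≠ 0)
  have h2 : (D : ℝ) = ((12 * ((i.1 : ℤ) - l.1) + 1 : ℤ) : ℝ) * (e i.1 l.1 hi hl : ℝ) := by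
    exact_mod_cast h1
  have hy' : (y : ℝ) ≠ 0 := by exact_mod_cast hy.ne'
  have h3 : (y : ℝ) ^ k * ((x : ℝ) / y) ^ (f i.1 l.1) = x ^ (f i.1 l.1) * y ^ (k - f i.1 l.1) := by
    have : (y : ℝ) ^ k = y ^ (f i.1 l.1) * y ^ (k - f i.1 l.1) := by
      rw [← pow_add, Nat.add_sub_cancel' (hf _ _ hi hl)]
    rw [this, div_pow]
    field_simp
  push_cast at hd h2
  rw [h2]
  generalize (-1 : ℝ) ^ (i.1 + l.1) * (k.choose i.1 : ℝ) * (k.choose l.1 : ℝ) = A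
  rw [mul_assoc (A), ← h3]
  field_simp

lemma aux_Q (c : ℝ) (h0 : 0 ≤ c) (h1 : c ≤ 1) (k : ℕ) :
    |∑ i ∈ Finset.range (k+1), ∑ l ∈ Finset.range (k+1),
        ((-1) ^ (i + l) * (k.choose i) * (k.choose l) * c ^ i /
          ((12 * ((i : ℤ) - l) + 1 : ℤ) : ℝ))| ≤ 4 ^ k := by
  have h4 : (4 : ℝ) ^ k = ∑ i ∈ Finset.range (k+1), ∑ l ∈ Finset.range (k+1),
      ((k.choose i : ℝ) * (k.choose l)) := by
    rw [← Finset.sum_mul_sum]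
    have := Nat.sum_range_choose k
    have h : (∑ i ∈ Finset.range (k+1), (k.choose i : ℝ)) = 2 ^ k := by exact_mod_cast this
    rw [h, ← mul_pow]; norm_num
  rw [h4]
  refine (Finset.abs_sum_le_sum_abs _ _).trans (Finset.sum_le_sum fun i _ => ?_)
  refine (Finset.abs_sum_le_sum_abs _ _).trans (Finset.sum_le_sum fun l _ => ?_)
  have hd : (1 : ℝ) ≤ |((12 * ((i : ℤ) - l) + 1 : ℤ) : ℝ)| := by
    rw [← Int.cast_abs]
    exact_mod_cast Int.one_le_abs (by omega)
  rw [abs_div, div_le_iff₀ (by linarith)]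
  have hc : c ^ i ≤ 1 := pow_le_one₀ h0 h1
  have hc0 : 0 ≤ c ^ i := by positivity
  simp only [abs_mul, abs_pow, abs_neg, abs_one, one_pow, one_mul, Nat.abs_cast, abs_of_nonneg h0]
  have hB : (0 : ℝ) ≤ (k.choose i : ℝ) * (k.choose l) := by positivity
  exact mul_le_mul_of_nonneg_left (hc.trans hd) hB

set_option maxHeartbeats 1000000 in
lemma aux_key : ∃ C0 : ℕ, ∀ x y : ℕ, 0 < x → C0 ≤ y → x < y → (y - x) ^ 12 ≤ y →
    ∃ U0 : ℕ, ∀ U V : ℕ, U0 ≤ U → x * U ^ 12 < y * V ^ 12 → y * V ^ 12 ≤ x * U ^ 12 + U →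
    False := by
  obtain ⟨K, hK2, hK⟩ := aux_lcm
  refine ⟨K ^ 3 + 48, fun x y hx hy hxy hgap => ⟨2 ^ 21 * y ^ 7 + 1, fun U V hU hlt hle => ?_⟩⟩
  have hy48 : 48 ≤ y := by omega
  have hKy : K ^ 3 ≤ y := by omega
  obtain ⟨g, hg⟩ : ∃ g, y = x + g := ⟨y - x, by omega⟩
  have hg1 : 1 ≤ g := by omega
  have hgap' : g ^ 12 ≤ y := by rwa [hg, Nat.add_sub_cancel_left, ← hg] at hgap
  have hKg : (K * g ^ 2) ^ 2 ≤ y := by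
    by_contra h
    push Not at h
    have h1 : y ^ 3 < ((K * g ^ 2) ^ 2) ^ 3 := Nat.pow_lt_pow_left h (by norm_num)
    have h2 : ((K * g ^ 2) ^ 2) ^ 3 = (K ^ 3) ^ 2 * g ^ 12 := by ring
    have h3 : (K ^ 3) ^ 2 * g ^ 12 ≤ y ^ 2 * y := by gcongr
    rw [h2] at h1
    have : y ^ 2 * y = y ^ 3 := by ring
    omega
  have hg4 : 4 * g ≤ y := by
    refine le_trans ?_ hKg
    calc 4 * g ≤ 4 * g ^ 4 := by gcongr; exact Nat.le_self_pow (by norm_num) g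
      _ = (2 * g ^ 2) ^ 2 := by ring
      _ ≤ _ := by gcongr
  -- choose k
  have hex : ∃ k, 4 * U ^ 2 < y ^ k := ⟨4 * U ^ 2, Nat.lt_pow_self (by omega)⟩
  obtain ⟨k, hk1, hk2, hk3⟩ : ∃ k, 1 ≤ k ∧ 4 * U ^ 2 < y ^ k ∧ y ^ k ≤ 4 * y * U ^ 2 := by
    classical
    have hU1 : 1 ≤ U := by omega
    have hsp := Nat.find_spec hex
    have hk0 : Nat.find hex ≠ 0 := by
      intro h0
      rw [h0, pow_zero] at hsp
      have : 1 ≤ U ^ 2 := Nat.one_le_pow _ _ hU1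
      omega
    obtain ⟨j, hj⟩ := Nat.exists_eq_succ_of_ne_zero hk0
    refine ⟨_, by omega, hsp, ?_⟩
    have hm := Nat.find_min hex (m := j) (by omega)
    rw [hj, Nat.succ_eq_add_one, pow_succ]
    push Not at hm
    calc y ^ j * y ≤ 4 * U ^ 2 * y := by gcongr
      _ = _ := by ring
  obtain ⟨D, hD0, hDK, hDd⟩ := hK k hk1
  have hyR : (0 : ℝ) < y := by exact_mod_cast (by omega : 0 < y)
  have hxR : (0 : ℝ) < x := by exact_mod_cast hx
  have hUR : (0 : ℝ) < U := by exact_mod_cast (by omega : 0 < U)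
  set c : ℝ := (x : ℝ) / y with hc
  have hc0 : 0 < c := by positivity
  have hc1 : c < 1 := by rw [hc, div_lt_one hyR]; exact_mod_cast hxy
  obtain ⟨α, hα0, hα⟩ : ∃ α : ℝ, 0 < α ∧ α ^ 12 = c :=
    ⟨c ^ ((12 : ℕ) : ℝ)⁻¹, by positivity, Real.rpow_inv_natCast_pow hc0.le (by norm_num)⟩
  have hα1 : α < 1 := by
    by_contra h
    push Not at h
    have := one_le_pow₀ h (n := 12)
    linarith
  have hαc : c ≤ α := by rw [← hα]; exact pow_le_of_le_one hα0.le hα1.le (by norm_num)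
  have he : 1 - c = g / y := by
    rw [hc, hg]; push_cast
    have : (x : ℝ) + g ≠ 0 := by positivity
    field_simp; ring
  have hc2 : 1 / 2 ≤ c := by
    have : (g : ℝ) / y ≤ 1 / 4 := by
      rw [div_le_iff₀ hyR]
      have : (4 : ℝ) * g ≤ y := by exact_mod_cast hg4
      linarith
    linarith
  have hexp := aux_expand_s14 α hα0 hα1 k
  obtain ⟨hub, hlb⟩ := aux_bounds α hα0 hα1 k
  rw [hexp] at hub hlb
  clear hexp
  rw [hα] at hub hlb
  obtain ⟨p, hp⟩ := aux_int x y k D (by omega) (fun i l => l) (fun i l _ h => h) hDd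
  obtain ⟨q, hq⟩ := aux_int x y k D (by omega) (fun i l => i) (fun i l h _ => h) hDd
  have hQ := aux_Q c hc0.le hc1.le k
  simp only [← hc] at hp hq
  set P := (∑ i ∈ Finset.range (k+1), ∑ l ∈ Finset.range (k+1),
        ((-1) ^ (i + l) * (k.choose i) * (k.choose l) * c ^ l /
          ((12 * ((i : ℤ) - l) + 1 : ℤ) : ℝ)))
  set Q := (∑ i ∈ Finset.range (k+1), ∑ l ∈ Finset.range (k+1),
        ((-1) ^ (i + l) * (k.choose i) * (k.choose l) * c ^ i /
          ((12 * ((i : ℤ) - l) + 1 : ℤ) : ℝ)))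
  clear_value P Q
  set R := P - α * Q with hR
  rw [he] at hub hlb
  -- linear form of the second solution
  have hV1 : (α * U) ^ 12 < (V : ℝ) ^ 12 := by
    rw [mul_pow, hα, hc, div_mul_eq_mul_div, div_lt_iff₀ hyR, mul_comm ((V:ℝ)^12)]
    exact_mod_cast hlt
  have hV2 : (V : ℝ) ^ 12 - (α * U) ^ 12 ≤ U := by
    have h1 : (y : ℝ) * V ^ 12 ≤ x * U ^ 12 + U := by exact_mod_cast hle
    have h2 : (y : ℝ) * (α * U) ^ 12 = x * U ^ 12 := by
      rw [mul_pow, hα, hc]; field_simp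
    have h3 : (1 : ℝ) ≤ y := by exact_mod_cast (by omega : 1 ≤ y)
    nlinarith
  have hVlt : α * U < V := lt_of_pow_lt_pow_left₀ 12 (by positivity) hV1
  have hVU : (U : ℝ) / 2 ≤ V := by nlinarith
  have hη : ((V : ℝ) - α * U) * U ^ 10 ≤ 2 ^ 11 := by
    have h1 : ((V : ℝ) - α * U) * V ^ 11 ≤ U := by
      refine le_trans ?_ hV2
      have : (α * U) ^ 12 ≤ (α * U) * V ^ 11 := by
        rw [pow_succ']
        gcongr
      nlinarith
    have h2 : ((V : ℝ) - α * U) * (U / 2) ^ 11 ≤ U := by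
      refine le_trans ?_ h1
      have : 0 ≤ (V : ℝ) - α * U := by linarith
      gcongr
    have h3 : (((V : ℝ) - α * U) * U ^ 10) * U ≤ 2 ^ 11 * U := by
      calc _ = (((V : ℝ) - α * U) * (U / 2) ^ 11) * 2 ^ 11 := by ring
        _ ≤ U * 2 ^ 11 := by gcongr
        _ = _ := by ring
    exact le_of_mul_le_mul_right h3 hUR
  -- upper bound for D y^k U R
  have hR0 : 0 ≤ R := le_trans (by positivity) hlb
  have hA : (D : ℝ) * y ^ k * (U * R) < 1 / 2 := by
    have h1 : (D : ℝ) * y ^ k * (U * R) ≤ U * ((K * g ^ 2 : ℝ) / y) ^ k := by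
      calc (D : ℝ) * y ^ k * (U * R) ≤ (K : ℝ) ^ k * y ^ k * (U * ((g : ℝ) / y) ^ (2 * k)) := by
            gcongr
        _ = U * (K * y * (g / y) ^ 2 : ℝ) ^ k := by rw [mul_pow, mul_pow, pow_mul]; ring
        _ = _ := by congr 2; field_simp
    refine lt_of_le_of_lt h1 ?_
    have h2 : ((U : ℝ) * ((K * g ^ 2 : ℝ) / y) ^ k) ^ 2 < (1 / 2) ^ 2 := by
      have h3 : ((K * g ^ 2 : ℝ) / y) ^ 2 ≤ 1 / y := by
        rw [div_pow, div_le_div_iff₀ (by positivity) hyR]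
        have : ((K : ℝ) * g ^ 2) ^ 2 ≤ y := by exact_mod_cast hKg
        nlinarith
      calc ((U : ℝ) * ((K * g ^ 2 : ℝ) / y) ^ k) ^ 2
          = (U : ℝ) ^ 2 * (((K * g ^ 2 : ℝ) / y) ^ 2) ^ k := by ring
        _ ≤ (U : ℝ) ^ 2 * (1 / y) ^ k := by gcongr
        _ = (U : ℝ) ^ 2 / y ^ k := by rw [one_div, inv_pow]; rfl
        _ < (1 / 2) ^ 2 := by
          rw [div_lt_iff₀ (by positivity)]
          have : (4 : ℝ) * U ^ 2 < y ^ k := by exact_mod_cast hk2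
          linarith
    exact lt_of_pow_lt_pow_left₀ 2 (by norm_num) h2
  have hk3R : (y : ℝ) ^ k ≤ 4 * y * U ^ 2 := by exact_mod_cast hk3
  have hy48R : (48 : ℝ) ≤ y := by exact_mod_cast hy48
  -- lower bound
  have hB : 1 / (256 * (y : ℝ) ^ 6 * U ^ 7) ≤ U * R := by
    have h1 : (1 / (y : ℝ) ^ 2) ^ (2 * k + 1) ≤ R := by
      refine le_trans ?_ hlb
      apply pow_le_pow_left₀ (by positivity)
      rw [div_div, div_le_div_iff₀ (by positivity) (by positivity)]
      have : (1 : ℝ) ≤ g := by exact_mod_cast hg1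
      nlinarith
    have h2 : 1 / ((y : ℝ) ^ 2 * (4 * y * U ^ 2) ^ 4) ≤ (1 / (y : ℝ) ^ 2) ^ (2 * k + 1) := by
      rw [div_pow, one_pow]
      apply one_div_le_one_div_of_le (by positivity)
      calc ((y : ℝ) ^ 2) ^ (2 * k + 1) = y ^ 2 * (y ^ k) ^ 4 := by ring
        _ ≤ _ := by gcongr
    calc 1 / (256 * (y : ℝ) ^ 6 * U ^ 7) = U * (1 / ((y : ℝ) ^ 2 * (4 * y * U ^ 2) ^ 4)) := by
          field_simp; norm_num
      _ ≤ U * R := by gcongr; exact h2.trans h1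
  have hE : |Q * (V - α * U)| < U * R := by
    refine lt_of_lt_of_le ?_ hB
    have hη0 : 0 ≤ (V : ℝ) - α * U := by linarith
    rw [abs_mul, abs_of_nonneg hη0]
    have h1 : |Q| ≤ 4 * y * U ^ 2 := by
      refine hQ.trans (le_trans ?_ hk3R)
      gcongr; linarith
    rw [lt_div_iff₀ (by positivity)]
    have hUy : (2 : ℝ) ^ 21 * y ^ 7 < U := by
      have : (2 : ℝ) ^ 21 * y ^ 7 + 1 ≤ U := by exact_mod_cast hU
      linarith
    have h5 : (|Q| * (V - α * U) * (256 * (y : ℝ) ^ 6 * U ^ 7)) * U < 1 * U := by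
      calc (|Q| * (V - α * U) * (256 * (y : ℝ) ^ 6 * U ^ 7)) * U
          ≤ ((4 * y * U ^ 2) * (V - α * U) * (256 * (y : ℝ) ^ 6 * U ^ 7)) * U := by gcongr
        _ = 1024 * y ^ 7 * ((V - α * U) * U ^ 10) := by ring
        _ ≤ 1024 * y ^ 7 * 2 ^ 11 := by gcongr
        _ = 2 ^ 21 * y ^ 7 := by ring
        _ < 1 * U := by linarith
    exact lt_of_mul_lt_mul_right h5 hUR.le
  have hN : ((U * p - V * q : ℤ) : ℝ) = D * y ^ k * (U * R - Q * (V - α * U)) := by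
    push_cast
    rw [← hp, ← hq, hR]; ring
  have hDy : (0 : ℝ) < D * y ^ k := by
    have : (0 : ℝ) < D := by exact_mod_cast hD0
    positivity
  obtain ⟨hE1, hE2⟩ := abs_lt.1 hE
  have hN0 : (0 : ℝ) < ((U * p - V * q : ℤ) : ℝ) := by
    rw [hN]; apply mul_pos hDy; linarith
  have hN1 : ((U * p - V * q : ℤ) : ℝ) < 1 := by
    rw [hN]
    have : D * y ^ k * (U * R - Q * (V - α * U)) < D * y ^ k * (2 * (U * R)) := by
      apply mul_lt_mul_of_pos_left _ hDy; linarith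
    linarith
  have a1 : (0 : ℤ) < U * p - V * q := by exact_mod_cast hN0
  have a2 : (U * p - V * q : ℤ) < 1 := by exact_mod_cast hN1
  omega

lemma aux_val_s14 (p r : ℕ) (hp : p.Prime) (hr : 2 ≤ r) :
    ∃ C : ℕ, ∀ v : ℕ, 1 ≤ v → (r ^ v - 1).factorization p ≤ C + Nat.log 2 v := by
  have := Fact.mk hp
  have hpos : ∀ v, 1 ≤ v → 1 < r ^ v := fun v hv => Nat.one_lt_pow (by omega) (by omega)
  by_cases hpr : p ∣ r
  · refine ⟨0, fun v hv => ?_⟩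
    rw [Nat.factorization_eq_zero_of_not_dvd]
    · omega
    · intro h
      have h1 : p ∣ r ^ v := dvd_pow hpr (by omega)
      have h2 : p ∣ r ^ v - (r ^ v - 1) := Nat.dvd_sub h1 h
      have := hpos v hv
      rw [show r ^ v - (r ^ v - 1) = 1 by omega] at h2
      exact hp.one_lt.ne' (Nat.dvd_one.1 h2)
  have hlog : ∀ v, padicValNat p v ≤ Nat.log 2 v := fun v =>
    (padicValNat_le_nat_log v).trans (Nat.log_anti_left (by norm_num) hp.two_le)
  rcases hp.eq_two_or_odd' with h2 | hodd
  · subst h2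
    refine ⟨padicValNat 2 (r + 1) + padicValNat 2 (r - 1), fun v hv => ?_⟩
    rw [Nat.factorization_def _ hp]
    have h1 := padicValNat.pow_two_sub_one (x := r) (n := 2 * v) (by omega) hpr (by omega) (by simp)
    have h3 : padicValNat 2 (2 * v) = 1 + padicValNat 2 v := by
      rw [padicValNat.mul (by norm_num) (by omega)]; simp
    have h4 : padicValNat 2 (r ^ v - 1) ≤ padicValNat 2 (r ^ (2 * v) - 1) := by
      have hd : r ^ v - 1 ∣ r ^ (2 * v) - 1 := Nat.pow_sub_one_dvd_pow_sub_one r (Dvd.intro_left 2 rfl)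
      have hne : r ^ (2 * v) - 1 ≠ 0 := by have := hpos (2 * v) (by omega); omega
      rw [← Nat.factorization_def _ hp, ← Nat.factorization_def _ hp]
      exact (Nat.factorization_le_iff_dvd (by have := hpos v hv; omega) hne).2 hd 2
    have := hlog v
    omega
  · have hd1 : 1 ≤ p - 1 := by have := hp.two_le; omega
    refine ⟨padicValNat p (r ^ (p - 1) - 1), fun v hv => ?_⟩
    rw [Nat.factorization_def _ hp]
    have hdvd : p ∣ r ^ (p - 1) - 1 := by
      have hcop : Nat.Coprime r p := ((Nat.Prime.coprime_iff_not_dvd hp).2 hpr).symm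
      have := Nat.ModEq.pow_totient hcop
      rw [Nat.totient_prime hp] at this
      exact (Nat.modEq_iff_dvd' (hpos _ hd1).le).1 this.symm
    have h1 := padicValNat.pow_sub_pow (p := p) (x := r ^ (p - 1)) (y := 1) hodd (hpos _ hd1) hdvd
      (fun h => hpr (hp.dvd_of_dvd_pow h)) (n := v) (by omega)
    rw [one_pow, ← pow_mul] at h1
    have h4 : padicValNat p (r ^ v - 1) ≤ padicValNat p (r ^ ((p - 1) * v) - 1) := by
      have hd : r ^ v - 1 ∣ r ^ ((p - 1) * v) - 1 :=
        Nat.pow_sub_one_dvd_pow_sub_one r (Dvd.intro_left _ rfl)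
      have hne : r ^ ((p - 1) * v) - 1 ≠ 0 := by
        have := hpos ((p - 1) * v) (Nat.mul_pos hd1 hv); omega
      rw [← Nat.factorization_def _ hp, ← Nat.factorization_def _ hp]
      exact (Nat.factorization_le_iff_dvd (by have := hpos v hv; omega) hne).2 hd p
    have := hlog v
    omega

lemma aux_minor (r s : ℕ) (hr : 2 ≤ r) (hs : 2 ≤ s) (hind : MultIndep r s) :
    ∃ p q : ℕ, p.Prime ∧ q.Prime ∧
      r.factorization p * s.factorization q ≠ r.factorization q * s.factorization p := by
  by_contra hcon
  push Not at hcon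
  obtain ⟨p, hp, hpr⟩ := Nat.exists_prime_and_dvd (by omega : r ≠ 1)
  have h1 : r ^ (s.factorization p) = s ^ (r.factorization p) := by
    apply Nat.eq_of_factorization_eq (by positivity) (by positivity)
    intro q
    by_cases hq : q.Prime
    · rw [Nat.factorization_pow, Nat.factorization_pow]
      simp only [Finsupp.smul_apply, smul_eq_mul]
      have := hcon p q hp hq
      linarith
    · rw [Nat.factorization_eq_zero_of_not_prime _ hq, Nat.factorization_eq_zero_of_not_prime _ hq]
  have h2 := (hind _ _ h1).2
  have := (hp.dvd_iff_one_le_factorization (by omega : r ≠ 0)).1 hpr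
  omega

lemma aux_diff (r s : ℕ) (hr : 2 ≤ r) (hs : 2 ≤ s) (m₁ m₂ : ℕ) (hm₁ : 0 < m₁) (hm₂ : 0 < m₂)
    (p : ℕ) (hp : p.Prime) : ∃ C : ℕ, ∀ u v w z : ℕ, 1 ≤ v → 1 ≤ z →
      m₂ * (r ^ u * (r ^ v - 1)) = m₁ * (s ^ w * (s ^ z - 1)) →
      |(u : ℤ) * r.factorization p - w * s.factorization p| ≤ C * (1 + Nat.log 2 (v + z)) := by
  obtain ⟨A, hA⟩ := aux_val_s14 p r hp hr
  obtain ⟨B, hB⟩ := aux_val_s14 p s hp hs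
  refine ⟨m₁.factorization p + m₂.factorization p + A + B + 1, fun u v w z hv hz h => ?_⟩
  have hr1 : r ^ v - 1 ≠ 0 := by
    have := Nat.one_lt_pow (n := v) (by omega) (by omega : 1 < r); omega
  have hs1 : s ^ z - 1 ≠ 0 := by
    have := Nat.one_lt_pow (n := z) (by omega) (by omega : 1 < s); omega
  have hru : r ^ u ≠ 0 := by positivity
  have hsw : s ^ w ≠ 0 := by positivity
  have h2 := congrArg (fun n => n.factorization p) h
  rw [Nat.factorization_mul hm₂.ne' (mul_ne_zero hru hr1), Nat.factorization_mul hru hr1,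
    Nat.factorization_mul hm₁.ne' (mul_ne_zero hsw hs1), Nat.factorization_mul hsw hs1,
    Nat.factorization_pow, Nat.factorization_pow] at h2
  simp only [Finsupp.add_apply, Finsupp.smul_apply, smul_eq_mul] at h2
  have hA' := hA v hv
  have hB' := hB z hz
  have l1 : Nat.log 2 v ≤ Nat.log 2 (v + z) := Nat.log_mono_right (by omega)
  have l2 : Nat.log 2 z ≤ Nat.log 2 (v + z) := Nat.log_mono_right (by omega)
  generalize Nat.log 2 (v + z) = L at *
  zify at h2 hA' hB' l1 l2
  have hL : (0 : ℤ) ≤ L := by positivity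
  have e1 : (0 : ℤ) ≤ m₁.factorization p := by positivity
  have e2 : (0 : ℤ) ≤ m₂.factorization p := by positivity
  have e3 : (0 : ℤ) ≤ (r ^ v - 1).factorization p := by positivity
  have e4 : (0 : ℤ) ≤ (s ^ z - 1).factorization p := by positivity
  push_cast
  have e5 : 0 ≤ (m₁.factorization p : ℤ) * L := by positivity
  have e6 : 0 ≤ (m₂.factorization p : ℤ) * L := by positivity
  have e7 : 0 ≤ (A : ℤ) * L := by positivity
  have e8 : 0 ≤ (B : ℤ) * L := by positivity
  rw [abs_le]
  constructor <;> nlinarith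

lemma aux_uw (r s : ℕ) (hr : 2 ≤ r) (hs : 2 ≤ s) (hind : MultIndep r s)
    (m₁ m₂ : ℕ) (hm₁ : 0 < m₁) (hm₂ : 0 < m₂) : ∃ C : ℕ, ∀ u v w z : ℕ, 1 ≤ v → 1 ≤ z →
      m₂ * (r ^ u * (r ^ v - 1)) = m₁ * (s ^ w * (s ^ z - 1)) →
      u ≤ C * (1 + Nat.log 2 (v + z)) ∧ w ≤ C * (1 + Nat.log 2 (v + z)) := by
  obtain ⟨p, q, hp, hq, hpq⟩ := aux_minor r s hr hs hind
  obtain ⟨A, hA⟩ := aux_diff r s hr hs m₁ m₂ hm₁ hm₂ p hp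
  obtain ⟨B, hB⟩ := aux_diff r s hr hs m₁ m₂ hm₁ hm₂ q hq
  refine ⟨(r.factorization p + r.factorization q + s.factorization p + s.factorization q) * (A + B),
    fun u v w z hv hz h => ?_⟩
  have h1 := hA u v w z hv hz h
  have h2 := hB u v w z hv hz h
  generalize Nat.log 2 (v + z) = L at *
  generalize r.factorization p = a at *
  generalize r.factorization q = b at *
  generalize s.factorization p = c at *
  generalize s.factorization q = d at *
  have hdet : (1 : ℤ) ≤ |(a : ℤ) * d - b * c| := by
    apply Int.one_le_abs
    intro h0
    apply hpq
    zify; linarith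
  have k1 : (u : ℤ) ≤ d * (A * (1 + L)) + c * (B * (1 + L)) := by
    calc (u : ℤ) ≤ u * |(a : ℤ) * d - b * c| := by nlinarith
      _ = |(d : ℤ) * (u * a - w * c) - c * (u * b - w * d)| := by
        rw [← abs_of_nonneg (by positivity : (0 : ℤ) ≤ u), ← abs_mul, abs_of_nonneg (by positivity : (0 : ℤ) ≤ u)]
        congr 1; ring
      _ ≤ |(d : ℤ) * (u * a - w * c)| + |(c : ℤ) * (u * b - w * d)| := abs_sub _ _
      _ = d * |(u * a - w * c : ℤ)| + c * |(u * b - w * d : ℤ)| := by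
        rw [abs_mul, abs_mul, Nat.abs_cast, Nat.abs_cast]
      _ ≤ _ := by gcongr
  have k2 : (w : ℤ) ≤ b * (A * (1 + L)) + a * (B * (1 + L)) := by
    calc (w : ℤ) ≤ w * |(a : ℤ) * d - b * c| := by nlinarith
      _ = |(b : ℤ) * (u * a - w * c) - a * (u * b - w * d)| := by
        rw [← abs_of_nonneg (by positivity : (0 : ℤ) ≤ w), ← abs_mul, abs_of_nonneg (by positivity : (0 : ℤ) ≤ w)]
        congr 1; ring
      _ ≤ |(b : ℤ) * (u * a - w * c)| + |(a : ℤ) * (u * b - w * d)| := abs_sub _ _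
      _ = b * |(u * a - w * c : ℤ)| + a * |(u * b - w * d : ℤ)| := by
        rw [abs_mul, abs_mul, Nat.abs_cast, Nat.abs_cast]
      _ ≤ _ := by gcongr
  norm_cast at k1 k2
  constructor
  · refine k1.trans ?_
    calc d * (A * (1 + L)) + c * (B * (1 + L)) ≤ (a + b + c + d) * (A * (1 + L)) +
          (a + b + c + d) * (B * (1 + L)) := by gcongr <;> omega
      _ = _ := by ring
  · refine k2.trans ?_
    calc b * (A * (1 + L)) + a * (B * (1 + L)) ≤ (a + b + c + d) * (A * (1 + L)) +
          (a + b + c + d) * (B * (1 + L)) := by gcongr <;> omega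
      _ = _ := by ring

lemma aux_log_s14 (A : ℕ) : ∃ N0 : ℕ, ∀ N, N0 ≤ N → A * (1 + Nat.log 2 N) ≤ N := by
  refine ⟨2 ^ (4 * A), fun N hN => ?_⟩
  have hN0 : N ≠ 0 := by
    have : 0 < 2 ^ (4 * A) := by positivity
    omega
  have h1 : 4 * A ≤ Nat.log 2 N := Nat.le_log_of_pow_le (by norm_num) hN
  have h2 := Nat.pow_log_le_self 2 hN0
  generalize Nat.log 2 N = L at *
  have h3 : L / 2 + 1 ≤ 2 ^ (L / 2) := Nat.lt_two_pow_self
  have h4 : 2 ^ (L / 2) * 2 ^ (L / 2) ≤ 2 ^ L := by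
    rw [← pow_add]; exact Nat.pow_le_pow_right (by norm_num) (by omega)
  have h5 : (L / 2 + 1) * (L / 2 + 1) ≤ 2 ^ (L / 2) * 2 ^ (L / 2) := by gcongr
  have h6 : 2 * A ≤ L / 2 + 1 := by omega
  have h7 : 1 + L ≤ 2 * (L / 2 + 1) := by omega
  calc A * (1 + L) ≤ A * (2 * (L / 2 + 1)) := by gcongr
    _ = (2 * A) * (L / 2 + 1) := by ring
    _ ≤ (L / 2 + 1) * (L / 2 + 1) := by gcongr
    _ ≤ N := by omega

lemma aux_final (r s : ℕ) (hr : 2 ≤ r) (hs : 2 ≤ s) (m₁ m₂ : ℕ) (hm₁ : 0 < m₁) (hm₂ : 0 < m₂)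
    (T : Set (ℕ × ℕ)) (hT : ∀ t ∈ T, m₂ * r ^ t.1 < m₁ * s ^ t.2 ∧
      (m₁ * s ^ t.2 - m₂ * r ^ t.1) ^ 13 ≤ m₁ * s ^ t.2) : T.Finite := by
  by_contra hinf
  obtain ⟨C0, hkey⟩ := aux_key
  -- pigeonhole
  obtain ⟨i, j, hT'⟩ : ∃ i j : ℕ, ¬ (T ∩ {t | t.1 % 12 = i ∧ t.2 % 12 = j}).Finite := by
    by_contra hcon
    push Not at hcon
    apply hinf
    have : T ⊆ ⋃ i ∈ Set.Iio 12, ⋃ j ∈ Set.Iio 12, (T ∩ {t | t.1 % 12 = i ∧ t.2 % 12 = j}) := by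
      intro t ht
      simp only [Set.mem_iUnion]
      exact ⟨t.1 % 12, Nat.mod_lt _ (by norm_num), t.2 % 12, Nat.mod_lt _ (by norm_num), ht, rfl, rfl⟩
    refine Set.Finite.subset ?_ this
    exact (Set.finite_Iio 12).biUnion fun i _ => (Set.finite_Iio 12).biUnion fun j _ => hcon i j
  have hbig : ∀ B : ℕ, ∃ a b : ℕ, (a, b) ∈ T ∧ a % 12 = i ∧ b % 12 = j ∧ B ≤ a ∧ B ≤ b := by
    intro B
    by_contra hcon
    push Not at hcon
    apply hT'
    set M := B + 2 * (m₂ * r ^ B) + 4 + m₁ * s ^ B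
    refine Set.Finite.subset ((Set.finite_Iio M).prod (Set.finite_Iio M)) ?_
    rintro ⟨a, b⟩ ⟨hab, h1, h2⟩
    simp only at h1 h2
    obtain ⟨hlt, hgap⟩ := hT _ hab
    simp only at hlt hgap
    have ha : a < m₂ * r ^ a := by
      calc a < r ^ a := Nat.lt_pow_self (by omega)
        _ ≤ m₂ * r ^ a := Nat.le_mul_of_pos_left _ hm₂
    have hb : b < m₁ * s ^ b := by
      calc b < s ^ b := Nat.lt_pow_self (by omega)
        _ ≤ m₁ * s ^ b := Nat.le_mul_of_pos_left _ hm₁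
    have hY : m₁ * s ^ b ≤ 2 * (m₂ * r ^ a) + 4 := by
      obtain ⟨g, hg⟩ : ∃ g, m₁ * s ^ b = m₂ * r ^ a + g := ⟨m₁ * s ^ b - m₂ * r ^ a, by omega⟩
      rw [hg, Nat.add_sub_cancel_left] at hgap
      have hg1 : 1 ≤ g := by omega
      have : g ^ 2 ≤ g ^ 13 := Nat.pow_le_pow_right hg1 (by norm_num)
      rw [hg]
      by_contra hc
      have h3 : m₂ * r ^ a + 4 < g := by omega
      nlinarith
    have hor : a < B ∨ b < B := by
      by_contra hc
      push Not at hc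
      exact absurd (hcon a b hab h1 h2 hc.1) (by omega)
    simp only [Set.mem_prod, Set.mem_Iio]
    rcases hor with h | h
    · have : m₂ * r ^ a ≤ m₂ * r ^ B := by gcongr; omega
      omega
    · have : m₁ * s ^ b ≤ m₁ * s ^ B := by gcongr; omega
      omega
  obtain ⟨a₁, b₁, hab₁, hi₁, hj₁, -, hb₁⟩ := hbig C0
  obtain ⟨hlt₁, hgap₁⟩ := hT _ hab₁
  simp only at hlt₁ hgap₁
  have hY₁ : C0 ≤ m₁ * s ^ b₁ := by
    calc C0 ≤ b₁ := hb₁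
      _ ≤ s ^ b₁ := (Nat.lt_pow_self (by omega)).le
      _ ≤ m₁ * s ^ b₁ := Nat.le_mul_of_pos_left _ hm₁
  have hX₁ : 0 < m₂ * r ^ a₁ := by positivity
  obtain ⟨U0, hU0⟩ := hkey _ _ hX₁ hY₁ hlt₁
    ((Nat.pow_le_pow_right (by omega) (by norm_num)).trans hgap₁)
  obtain ⟨a₂, b₂, hab₂, hi₂, hj₂, ha₂, hb₂⟩ := hbig (a₁ + b₁ + 12 * (U0 + m₂ * r ^ a₁))
  obtain ⟨hlt₂, hgap₂⟩ := hT _ hab₂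
  simp only at hlt₂ hgap₂
  obtain ⟨h, hh⟩ : ∃ h, a₂ = a₁ + h * 12 := ⟨(a₂ - a₁) / 12, by omega⟩
  obtain ⟨h', hh'⟩ : ∃ h, b₂ = b₁ + h * 12 := ⟨(b₂ - b₁) / 12, by omega⟩
  have hhbig : U0 + m₂ * r ^ a₁ ≤ h := by omega
  have hrh : h < r ^ h := Nat.lt_pow_self (by omega)
  have eX : m₂ * r ^ a₂ = m₂ * r ^ a₁ * (r ^ h) ^ 12 := by rw [hh, pow_add, pow_mul, mul_assoc]
  have eY : m₁ * s ^ b₂ = m₁ * s ^ b₁ * (s ^ h') ^ 12 := by rw [hh', pow_add, pow_mul, mul_assoc]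
  rw [eX, eY] at hlt₂ hgap₂
  refine hU0 (r ^ h) (s ^ h') (by omega) hlt₂ ?_
  generalize m₂ * r ^ a₁ = X at *
  generalize m₁ * s ^ b₁ = Y at *
  generalize r ^ h = U at *
  generalize s ^ h' = V at *
  obtain ⟨g, hg⟩ : ∃ g, Y * V ^ 12 = X * U ^ 12 + g := ⟨Y * V ^ 12 - X * U ^ 12, by omega⟩
  rw [hg, Nat.add_sub_cancel_left] at hgap₂
  rw [hg]
  by_contra hc
  have hgU : U + 1 ≤ g := by omega
  have h1 : U ^ 12 + 1 ≤ g ^ 12 := Nat.pow_lt_pow_left hgU (by norm_num)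
  have h2 : g * (U ^ 12 + 1) ≤ g * g ^ 12 := by gcongr
  have h3 : g * g ^ 12 = g ^ 13 := by ring
  have h4 : g * U ^ 12 ≤ X * U ^ 12 := by nlinarith
  have h5 : 0 < U ^ 12 := by have : 0 < U := by omega
                             positivity
  have := Nat.le_of_mul_le_mul_right h4 h5
  omega

lemma aux_gap (s m₁ C : ℕ) : ∃ V0 : ℕ, ∀ N w Y : ℕ, V0 ≤ N → w ≤ C * (1 + Nat.log 2 N) →
    2 ^ N ≤ Y ^ 2 → (m₁ * s ^ w) ^ 13 ≤ Y := by
  obtain ⟨N0, hN0⟩ := aux_log_s14 (26 * (m₁ + s * C))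
  refine ⟨N0, fun N w Y hN hw hY => ?_⟩
  have h1 := hN0 N hN
  generalize Nat.log 2 N = L at *
  have h2 : m₁ * s ^ w ≤ 2 ^ (m₁ + s * w) := by
    rw [pow_add, pow_mul]
    have a1 : m₁ < 2 ^ m₁ := Nat.lt_two_pow_self
    have a2 : s < 2 ^ s := Nat.lt_two_pow_self
    gcongr
  have h3 : 26 * (m₁ + s * w) ≤ N := by
    refine le_trans ?_ h1
    have : s * w ≤ s * (C * (1 + L)) := by gcongr
    nlinarith
  have h4 : ((m₁ * s ^ w) ^ 13) ^ 2 ≤ Y ^ 2 := by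
    calc ((m₁ * s ^ w) ^ 13) ^ 2 ≤ ((2 ^ (m₁ + s * w)) ^ 13) ^ 2 := by gcongr
      _ = 2 ^ (26 * (m₁ + s * w)) := by rw [← pow_mul, ← pow_mul]; congr 1; ring
      _ ≤ 2 ^ N := Nat.pow_le_pow_right (by norm_num) h3
      _ ≤ Y ^ 2 := hY
  exact le_of_pow_le_pow_left₀ (by norm_num) (by omega) h4

theorem stmt14 (r s : ℕ) (hr : 2 ≤ r) (hs : 2 ≤ s) (hind : MultIndep r s)
    (m₁ m₂ : ℕ) (hm₁ : 0 < m₁) (hm₂ : 0 < m₂) :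
    {z : ℕ × ℕ × ℕ × ℕ | 1 ≤ z.2.1 ∧ 1 ≤ z.2.2.2 ∧
      ((r : ℚ) ^ z.1 * ((r : ℚ) ^ z.2.1 - 1)) / (m₁ : ℚ)
        = ((s : ℚ) ^ z.2.2.1 * ((s : ℚ) ^ z.2.2.2 - 1)) / (m₂ : ℚ)}.Finite := by
  obtain ⟨C, hC⟩ := aux_uw r s hr hs hind m₁ m₂ hm₁ hm₂
  obtain ⟨V1, hV1⟩ := aux_gap s m₁ C
  obtain ⟨V2, hV2⟩ := aux_gap r m₂ C
  set S := {z : ℕ × ℕ × ℕ × ℕ | 1 ≤ z.2.1 ∧ 1 ≤ z.2.2.2 ∧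
      ((r : ℚ) ^ z.1 * ((r : ℚ) ^ z.2.1 - 1)) / (m₁ : ℚ)
        = ((s : ℚ) ^ z.2.2.1 * ((s : ℚ) ^ z.2.2.2 - 1)) / (m₂ : ℚ)} with hS
  have hSol : ∀ u v w z : ℕ, (u, v, w, z) ∈ S → 1 ≤ v ∧ 1 ≤ z ∧
      m₂ * (r ^ u * (r ^ v - 1)) = m₁ * (s ^ w * (s ^ z - 1)) := by
    rintro u v w z ⟨h1, h2, h3⟩
    simp only at h1 h2 h3
    refine ⟨h1, h2, ?_⟩
    have q1 : (m₁ : ℚ) ≠ 0 := by exact_mod_cast hm₁.ne'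
    have q2 : (m₂ : ℚ) ≠ 0 := by exact_mod_cast hm₂.ne'
    rw [div_eq_div_iff q1 q2] at h3
    have p1 : 1 ≤ r ^ v := Nat.one_le_pow _ _ (by omega)
    have p2 : 1 ≤ s ^ z := Nat.one_le_pow _ _ (by omega)
    have h4 : ((m₂ * (r ^ u * (r ^ v - 1)) : ℕ) : ℚ) = ((m₁ * (s ^ w * (s ^ z - 1)) : ℕ) : ℚ) := by
      push_cast [Nat.cast_sub p1, Nat.cast_sub p2]
      linarith
    exact_mod_cast h4
  have hlt : ∀ u v w z : ℕ, (u, v, w, z) ∈ S →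
      m₂ * r ^ (u + v) + m₁ * s ^ w = m₁ * s ^ (w + z) + m₂ * r ^ u := by
    intro u v w z h
    obtain ⟨-, -, h3⟩ := hSol u v w z h
    obtain ⟨x, hx⟩ : ∃ x, r ^ v = x + 1 :=
      ⟨r ^ v - 1, by have : 1 ≤ r ^ v := Nat.one_le_pow _ _ (by omega)
                     omega⟩
    obtain ⟨y, hy⟩ : ∃ y, s ^ z = y + 1 :=
      ⟨s ^ z - 1, by have : 1 ≤ s ^ z := Nat.one_le_pow _ _ (by omega)
                     omega⟩
    rw [pow_add, pow_add]
    rw [hx, hy] at h3 ⊢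
    simp only [Nat.add_sub_cancel] at h3
    linarith
  have hpow : ∀ u v w z : ℕ, r ^ v ≤ m₂ * r ^ (u + v) ∧ s ^ z ≤ m₁ * s ^ (w + z) := by
    intro u v w z
    constructor
    · calc r ^ v ≤ r ^ (u + v) := Nat.pow_le_pow_right (by omega) (by omega)
        _ ≤ _ := Nat.le_mul_of_pos_left _ hm₂
    · calc s ^ z ≤ s ^ (w + z) := Nat.pow_le_pow_right (by omega) (by omega)
        _ ≤ _ := Nat.le_mul_of_pos_left _ hm₁
  have hsq : ∀ v z Y : ℕ, r ^ v ≤ Y → s ^ z ≤ Y → 2 ^ (v + z) ≤ Y ^ 2 := by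
    intro v z Y h1 h2
    rw [pow_add, sq]
    exact Nat.mul_le_mul ((Nat.pow_le_pow_left hr v).trans h1) ((Nat.pow_le_pow_left hs z).trans h2)
  -- the two sets of exponent pairs
  have hT1 := aux_final r s hr hs m₁ m₂ hm₁ hm₂
    {t | m₂ * r ^ t.1 < m₁ * s ^ t.2 ∧ (m₁ * s ^ t.2 - m₂ * r ^ t.1) ^ 13 ≤ m₁ * s ^ t.2}
    (fun t ht => ht)
  have hT2 := aux_final s r hs hr m₂ m₁ hm₂ hm₁
    {t | m₁ * s ^ t.1 < m₂ * r ^ t.2 ∧ (m₂ * r ^ t.2 - m₁ * s ^ t.1) ^ 13 ≤ m₂ * r ^ t.2}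
    (fun t ht => ht)
  obtain ⟨M1, hM1⟩ := (hT1.image (fun t => t.1 + t.2)).bddAbove
  obtain ⟨M2, hM2⟩ := (hT2.image (fun t => t.1 + t.2)).bddAbove
  set W := V1 + V2 with hW
  set M := M1 + M2 + W + C * (1 + Nat.log 2 W) with hM
  refine Set.Finite.subset ((Set.finite_Iic M).prod ((Set.finite_Iic M).prod
    ((Set.finite_Iic M).prod (Set.finite_Iic M)))) ?_
  rintro ⟨u, v, w, z⟩ h
  simp only [Set.mem_prod, Set.mem_Iic]
  obtain ⟨hv, hz, heq⟩ := hSol u v w z h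
  obtain ⟨hu, hw⟩ := hC u v w z hv hz heq
  by_cases hsmall : v + z < W
  · have : C * (1 + Nat.log 2 (v + z)) ≤ C * (1 + Nat.log 2 W) := by
      gcongr
    omega
  have hadd := hlt u v w z h
  obtain ⟨p1, p2⟩ := hpow u v w z
  rcases lt_trichotomy (m₂ * r ^ (u + v)) (m₁ * s ^ (w + z)) with hc | hc | hc
  · have hmem : (u + v, w + z) ∈ {t : ℕ × ℕ | m₂ * r ^ t.1 < m₁ * s ^ t.2 ∧
        (m₁ * s ^ t.2 - m₂ * r ^ t.1) ^ 13 ≤ m₁ * s ^ t.2} := by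
      refine ⟨hc, ?_⟩
      simp only
      refine le_trans (Nat.pow_le_pow_left (?_ : _ ≤ m₁ * s ^ w) 13)
        (hV1 (v + z) w _ (by omega) hw (hsq v z _ (p1.trans hc.le) p2))
      omega
    have := hM1 (Set.mem_image_of_mem _ hmem)
    simp only at this
    omega
  · exfalso
    have h1 : m₁ * s ^ w = m₂ * r ^ u := by omega
    rw [pow_add, pow_add, ← mul_assoc, ← mul_assoc, h1] at hc
    have h2 : r ^ v = s ^ z := Nat.eq_of_mul_eq_mul_left (by positivity) hc
    have := (hind v z h2).1
    omega
  · have hmem : (w + z, u + v) ∈ {t : ℕ × ℕ | m₁ * s ^ t.1 < m₂ * r ^ t.2 ∧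
        (m₂ * r ^ t.2 - m₁ * s ^ t.1) ^ 13 ≤ m₂ * r ^ t.2} := by
      refine ⟨hc, ?_⟩
      simp only
      refine le_trans (Nat.pow_le_pow_left (?_ : _ ≤ m₂ * r ^ u) 13)
        (hV2 (v + z) u _ (by omega) hu (hsq v z _ p1 (p2.trans hc.le)))
      omega
    have := hM2 (Set.mem_image_of_mem _ hmem)
    simp only at this
    omega
end
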